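/- Let $V$ be a separable Hilbert space, $H\in(1/2,1)$, $-\infty\le\alpha<\beta\le\infty$, and let $f(t,x,\theta)$ be a $V$-valued function on $\mathbb{R}\times\mathbb{R}^d\times(\alpha,\beta)$, jointly measurable, infinitely differentiable with compact support in $(t,x)$ (as a function with values in $L^{1/H}((\alpha,\beta);V)$). Then for every $(t,x)\in\mathbb{R}\times\mathbb{R}^d$: $(\mathcal{G}f)^{\#}(t,x)\;\le\;N\left(\mathbb{M}_t\big[F_f(\cdot,x)\big](t)\right)^{1/2},$ where $N$ depends only on $d$ and $F_f(t,x):=\left(\int_\alpha^\beta\big(\mathbb{M}_x[\|f(t,\cdot,\theta)\|_V^2](x)\big)^{1/(2H)}\,d\theta\right)^{2H}$. -/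

import Mathlib

open MeasureTheory ENNReal

/-- The heat kernel `G_t(x) = (4πt)^{-d/2} exp(-|x|²/(4t))` on `ℝ^d`. -/
noncomputable def heatKernel (d : ℕ) (t : ℝ) (x : EuclideanSpace ℝ (Fin d)) : ℝ :=
  (4 * Real.pi * t) ^ (-(d : ℝ)/2) * Real.exp (-‖x‖^2 / (4*t))

/-- The heat semigroup `T_t h (x) = ∫_{ℝ^d} h(x-y) G_t(y) dy` (Bochner integral). -/
noncomputable def heatOp (d : ℕ) {V : Type*} [NormedAddCommGroup V] [NormedSpace ℝ V]
    [CompleteSpace V] (t : ℝ) (h : EuclideanSpace ℝ (Fin d) → V)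
    (x : EuclideanSpace ℝ (Fin d)) : V :=
  ∫ y, heatKernel d t y • h (x - y)

/-- Squared norm of the spatial gradient of `T_t h` at `x`:
`‖∇ T_t h(x)‖² = ∑_{j=1}^d ‖∂_{x_j} T_t h(x)‖²`. -/
noncomputable def gradHeatNormSq (d : ℕ) {V : Type*} [NormedAddCommGroup V]
    [NormedSpace ℝ V] [CompleteSpace V] (t : ℝ) (h : EuclideanSpace ℝ (Fin d) → V)
    (x : EuclideanSpace ℝ (Fin d)) : ℝ :=
  ∑ j : Fin d, ‖fderiv ℝ (heatOp d t h) x (EuclideanSpace.single j 1)‖^2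

/-- The square-function operator
`𝒢f(t,x) = [∫_{-∞}^t (∫_α^β ‖∇T_{t-s}f(s,·,θ)(x)‖^{1/H} dθ)^{2H} ds]^{1/2}`
(note `‖∇T_{t-s}f(s,·,θ)(x)‖^{1/H} = (gradHeatNormSq ...)^{1/(2H)}`). -/
noncomputable def calG (d : ℕ) {V : Type*} [NormedAddCommGroup V] [NormedSpace ℝ V]
    [CompleteSpace V] (H : ℝ) (α β : EReal)
    (f : ℝ → EuclideanSpace ℝ (Fin d) → ℝ → V)
    (t : ℝ) (x : EuclideanSpace ℝ (Fin d)) : ℝ :=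
  (∫ s in Set.Iio t,
      (∫ θ in {θ : ℝ | α < (θ : EReal) ∧ (θ : EReal) < β},
        (gradHeatNormSq d (t - s) (fun y => f s y θ) x) ^ (1/(2*H))) ^ (2*H))
    ^ ((1:ℝ)/2)

/-- Hardy–Littlewood maximal function over balls in `ℝ^d`:
`𝕄_x g(x) = sup_{r>0} |B_r|⁻¹ ∫_{B_r(x)} |g(y)| dy`. -/
noncomputable def maxX (d : ℕ) (g : EuclideanSpace ℝ (Fin d) → ℝ)
    (x : EuclideanSpace ℝ (Fin d)) : ℝ≥0∞ :=
  ⨆ (r : ℝ) (_ : 0 < r),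
    (volume (Metric.ball x r))⁻¹ * ∫⁻ y in Metric.ball x r, ENNReal.ofReal |g y|

/-- Hardy–Littlewood maximal function over intervals in `ℝ`:
`𝕄_t k(t) = sup_{r>0} (2r)⁻¹ ∫_{t-r}^{t+r} |k(s)| ds`. -/
noncomputable def maxT (k : ℝ → ℝ≥0∞) (t : ℝ) : ℝ≥0∞ :=
  ⨆ (r : ℝ) (_ : 0 < r),
    (ENNReal.ofReal (2*r))⁻¹ * ∫⁻ s in Set.Ioo (t - r) (t + r), k s

/-- `F_f(t,x) = (∫_α^β (𝕄_x[‖f(t,·,θ)‖²](x))^{1/(2H)} dθ)^{2H}`. -/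
noncomputable def Ff (d : ℕ) {V : Type*} [NormedAddCommGroup V] (H : ℝ) (α β : EReal)
    (f : ℝ → EuclideanSpace ℝ (Fin d) → ℝ → V)
    (t : ℝ) (x : EuclideanSpace ℝ (Fin d)) : ℝ≥0∞ :=
  (∫⁻ θ in {θ : ℝ | α < (θ : EReal) ∧ (θ : EReal) < β},
      (maxX d (fun y => ‖f t y θ‖^2) x) ^ (1/(2*H))) ^ (2*H)

/-- The cube `Q₀ = [-4,0] × [-1,1]^d ⊆ ℝ^{d+1}`. -/
def cubeQ0 (d : ℕ) : Set (ℝ × EuclideanSpace ℝ (Fin d)) :=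
  Set.Icc (-4 : ℝ) 0 ×ˢ {x | ∀ j, x j ∈ Set.Icc (-1 : ℝ) 1}

/-- The parabolic dyadic cell of generation `n` containing the point `q = (t,x)`:
`Q_n(q) = [i₀4^{-n},(i₀+1)4^{-n}) × ∏_j [i_j 2^{-n},(i_j+1)2^{-n})` with
`i₀ = ⌊t·4ⁿ⌋`, `i_j = ⌊x_j·2ⁿ⌋`. -/
noncomputable def dyadicCell (d : ℕ) (n : ℤ) (q : ℝ × EuclideanSpace ℝ (Fin d)) :
    Set (ℝ × EuclideanSpace ℝ (Fin d)) :=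
  Set.Ico ((⌊q.1 * (4:ℝ)^n⌋ : ℝ) * (4:ℝ)^(-n)) (((⌊q.1 * (4:ℝ)^n⌋ : ℝ) + 1) * (4:ℝ)^(-n)) ×ˢ
    {y | ∀ j, y j ∈ Set.Ico ((⌊q.2 j * (2:ℝ)^n⌋ : ℝ) * (2:ℝ)^(-n))
      (((⌊q.2 j * (2:ℝ)^n⌋ : ℝ) + 1) * (2:ℝ)^(-n))}

/-- The average `g_{|n}(q) = |Q_n(q)|⁻¹ ∫_{Q_n(q)} g`. -/
noncomputable def cellAvg (d : ℕ) (g : ℝ × EuclideanSpace ℝ (Fin d) → ℝ) (n : ℤ)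
    (q : ℝ × EuclideanSpace ℝ (Fin d)) : ℝ :=
  (volume (dyadicCell d n q)).toReal⁻¹ * ∫ p in dyadicCell d n q, g p

/-- The sharp function
`g^#(q) = sup_{n ∈ ℤ} |Q_n(q)|⁻¹ ∫_{Q_n(q)} |g - g_{|n}(q)|`. -/
noncomputable def sharpFn (d : ℕ) (g : ℝ × EuclideanSpace ℝ (Fin d) → ℝ)
    (q : ℝ × EuclideanSpace ℝ (Fin d)) : ℝ≥0∞ :=
  ⨆ n : ℤ, (volume (dyadicCell d n q))⁻¹ *
    ∫⁻ p in dyadicCell d n q, ENNReal.ofReal |g p - cellAvg d g n q|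

section Kernel

variable {d : ℕ}

local notation "𝔼" => EuclideanSpace ℝ (Fin d)

lemma heatKernel_pos {t : ℝ} (ht : 0 < t) (x : 𝔼) : 0 < heatKernel d t x := by
  unfold heatKernel
  positivity

lemma continuous_heatKernel (t : ℝ) : Continuous (heatKernel d t) := by
  unfold heatKernel
  fun_prop

lemma measurable_heatKernel_uncurry :
    Measurable (fun p : ℝ × 𝔼 => heatKernel d p.1 p.2) := by
  unfold heatKernel
  fun_prop

lemma heatKernel_neg (t : ℝ) (x : 𝔼) : heatKernel d t (-x) = heatKernel d t x := by
  simp [heatKernel]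

lemma heatKernel_eq (t : ℝ) :
    heatKernel d t =
      fun x => (4 * Real.pi * t) ^ (-(d : ℝ) / 2) * Real.exp (-(1 / (4 * t)) * ‖x‖ ^ 2) := by
  ext x
  unfold heatKernel
  congr 2
  ring

lemma integral_heatKernel {t : ℝ} (ht : 0 < t) : ∫ x, heatKernel d t x = 1 := by
  rw [heatKernel_eq, integral_const_mul,
    GaussianFourier.integral_rexp_neg_mul_sq_norm (by positivity), finrank_euclideanSpace_fin]
  rw [show Real.pi / (1 / (4 * t)) = 4 * Real.pi * t by field_simp,
    ← Real.rpow_add (by positivity)]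
  ring_nf
  simp

lemma integrable_heatKernel {t : ℝ} (ht : 0 < t) : Integrable (heatKernel d t) := by
  by_contra h
  have := integral_heatKernel (d := d) ht
  rw [integral_undef h] at this
  exact zero_ne_one this

lemma integrable_heatKernel_sub {t : ℝ} (ht : 0 < t) (x : 𝔼) :
    Integrable (fun y => heatKernel d t (x - y)) :=
  (integrable_heatKernel ht).comp_sub_left x

lemma integral_heatKernel_sub {t : ℝ} (ht : 0 < t) (x : 𝔼) :
    ∫ y, heatKernel d t (x - y) = 1 := by
  rw [integral_sub_left_eq_self (heatKernel d t), integral_heatKernel ht]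

lemma lintegral_heatKernel_sub {t : ℝ} (ht : 0 < t) (x : 𝔼) :
    ∫⁻ y, ENNReal.ofReal (heatKernel d t (x - y)) = 1 := by
  rw [← ofReal_integral_eq_lintegral_ofReal (integrable_heatKernel_sub ht x)
    (Filter.Eventually.of_forall fun y => (heatKernel_pos ht _).le),
    integral_heatKernel_sub ht, ENNReal.ofReal_one]

lemma rpow_two_mul_heatKernel {t : ℝ} (ht : 0 < t) (x : 𝔼) :
    (2 : ℝ) ^ ((d : ℝ) / 2) * heatKernel d (2 * t) x =
      (4 * Real.pi * t) ^ (-(d : ℝ) / 2) * Real.exp (-‖x‖ ^ 2 / (8 * t)) := by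
  unfold heatKernel
  rw [show 4 * Real.pi * (2 * t) = 2 * (4 * Real.pi * t) by ring,
    Real.mul_rpow (by positivity) (by positivity), ← mul_assoc, ← mul_assoc,
    ← Real.rpow_add (by positivity)]
  ring_nf
  simp

/-- Moving the argument by at most a multiple of `√t` costs a doubling of the time. -/
lemma heatKernel_le_of_near {t A : ℝ} (ht : 0 < t) {z z₀ : 𝔼} (h : ‖z - z₀‖ ^ 2 ≤ A * t) :
    heatKernel d t z ≤
      Real.exp (A / 4) * ((2 : ℝ) ^ ((d : ℝ) / 2) * heatKernel d (2 * t) z₀) := by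
  rw [rpow_two_mul_heatKernel ht, heatKernel, mul_left_comm, ← Real.exp_add]
  gcongr
  have h1 : ‖z₀‖ ≤ ‖z‖ + ‖z - z₀‖ := by
    have := norm_sub_le z (z - z₀)
    simpa using this
  have h2 : ‖z₀‖ ^ 2 ≤ 2 * ‖z‖ ^ 2 + 2 * (A * t) := by
    nlinarith [sq_nonneg (‖z‖ - ‖z - z₀‖), norm_nonneg z₀, norm_nonneg z, norm_nonneg (z - z₀)]
  rw [div_add_div _ _ (by norm_num) (by positivity), div_le_div_iff₀ (by positivity) (by positivity)]
  nlinarith [mul_pos ht ht]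

lemma le_exp_half (u : ℝ) : u ≤ Real.exp (u / 2) := by
  have h : Real.exp (u / 2) = Real.exp (u / 4) ^ 2 := by
    rw [← Real.exp_nat_mul]
    congr 1
    push_cast
    ring
  rw [h]
  by_cases hu : u ≤ 0
  · exact hu.trans (by positivity)
  · have := Real.add_one_le_exp (u / 4)
    nlinarith [sq_nonneg (u / 4 - 1)]

lemma sq_norm_mul_heatKernel_le {t : ℝ} (ht : 0 < t) (z : 𝔼) :
    ‖z‖ ^ 2 / (4 * t) * heatKernel d t z ≤ (2 : ℝ) ^ ((d : ℝ) / 2) * heatKernel d (2 * t) z := by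
  rw [rpow_two_mul_heatKernel ht, heatKernel, mul_left_comm]
  gcongr
  calc ‖z‖ ^ 2 / (4 * t) * Real.exp (-‖z‖ ^ 2 / (4 * t))
      ≤ Real.exp (‖z‖ ^ 2 / (4 * t) / 2) * Real.exp (-‖z‖ ^ 2 / (4 * t)) := by
        gcongr
        exact le_exp_half _
    _ = Real.exp (-‖z‖ ^ 2 / (8 * t)) := by
        rw [← Real.exp_add]
        congr 1
        field_simp
        ring

/-- The Chapman–Kolmogorov identity for the heat kernel. -/
lemma integral_heatKernel_mul_heatKernel {a b : ℝ} (ha : 0 < a) (hb : 0 < b) (x y : 𝔼) :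
    ∫ w, heatKernel d a (x - w) * heatKernel d b (w - y) = heatKernel d (a + b) (x - y) := by
  have hab : 0 < a + b := by positivity
  set σ : ℝ := a * b / (a + b) with hσ
  have hσ0 : 0 < σ := by positivity
  set c : 𝔼 := (b / (a + b)) • x + (a / (a + b)) • y with hc
  have key : ∀ w : 𝔼, heatKernel d a (x - w) * heatKernel d b (w - y) =
      heatKernel d (a + b) (x - y) * heatKernel d σ (c - w) := by
    intro w
    unfold heatKernel
    rw [mul_mul_mul_comm, mul_mul_mul_comm (_ ^ _) _ (_ ^ _), ← Real.mul_rpow (by positivity) (by positivity),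
      ← Real.mul_rpow (by positivity) (by positivity), ← Real.exp_add, ← Real.exp_add]
    congr 2
    · rw [hσ]
      field_simp
    · set p := x - w with hp
      set q := w - y with hq
      have h1 : x - y = p + q := by rw [hp, hq]; abel
      have h2 : c - w = (b / (a + b)) • p - (a / (a + b)) • q := by
        have : w = (b / (a + b)) • w + (a / (a + b)) • w := by
          rw [← add_smul, ← add_div, add_comm b a, div_self hab.ne', one_smul]
        rw [hc, hp, hq, smul_sub, smul_sub]
        nth_rewrite 1 [this]
        abel
      rw [h1, h2]
      clear_value p q
      rw [norm_add_sq_real, norm_sub_sq_real, norm_smul, norm_smul, inner_smul_left,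
        inner_smul_right, Real.norm_of_nonneg (by positivity), Real.norm_of_nonneg (by positivity),
        hσ]
      simp only [conj_trivial]
      field_simp
      ring
  simp_rw [key]
  rw [integral_const_mul, integral_heatKernel_sub hσ0, mul_one]

end Kernel

section HeatOp

variable {d : ℕ}

local notation "𝔼" => EuclideanSpace ℝ (Fin d)

lemma lintegral_heatKernel_mul_heatKernel {a b : ℝ} (ha : 0 < a) (hb : 0 < b) (x y : 𝔼) :
    ∫⁻ w, ENNReal.ofReal (heatKernel d a (x - w)) * ENNReal.ofReal (heatKernel d b (w - y)) =
      ENNReal.ofReal (heatKernel d (a + b) (x - y)) := by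
  have h := integral_heatKernel_mul_heatKernel ha hb x y
  have hpos := heatKernel_pos (add_pos ha hb) (x - y)
  have hint : Integrable (fun w => heatKernel d a (x - w) * heatKernel d b (w - y)) := by
    by_contra hn
    rw [integral_undef hn] at h
    exact hpos.ne h
  rw [← h, ofReal_integral_eq_lintegral_ofReal hint (Filter.Eventually.of_forall fun w =>
    (mul_pos (heatKernel_pos ha _) (heatKernel_pos hb _)).le)]
  congr 1 with w
  rw [ENNReal.ofReal_mul (heatKernel_pos ha _).le]

/-- The heat semigroup acting on functions with values in `[0, ∞]`. -/
noncomputable def heatLint (d : ℕ) (t : ℝ) (g : EuclideanSpace ℝ (Fin d) → ℝ≥0∞)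
    (x : EuclideanSpace ℝ (Fin d)) : ℝ≥0∞ :=
  ∫⁻ y, ENNReal.ofReal (heatKernel d t (x - y)) * g y

lemma heatLint_mono (t : ℝ) {g g' : 𝔼 → ℝ≥0∞} (h : ∀ y, g y ≤ g' y) (x : 𝔼) :
    heatLint d t g x ≤ heatLint d t g' x :=
  lintegral_mono fun y => by gcongr; exact h y

lemma heatLint_const {t : ℝ} (ht : 0 < t) (c : ℝ≥0∞) (x : 𝔼) :
    heatLint d t (fun _ => c) x = c := by
  unfold heatLint
  rw [lintegral_mul_const, lintegral_heatKernel_sub ht, one_mul]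
  exact ENNReal.measurable_ofReal.comp
    ((continuous_heatKernel t).measurable.comp (measurable_const.sub measurable_id))

lemma heatLint_heatLint {a b : ℝ} (ha : 0 < a) (hb : 0 < b) {g : 𝔼 → ℝ≥0∞} (hg : Measurable g)
    (x : 𝔼) : heatLint d a (heatLint d b g) x = heatLint d (a + b) g x := by
  unfold heatLint
  have hm (t : ℝ) : Measurable (heatKernel d t) := (continuous_heatKernel t).measurable
  have h1 : ∀ w, ENNReal.ofReal (heatKernel d a (x - w)) *
      ∫⁻ y, ENNReal.ofReal (heatKernel d b (w - y)) * g y =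
      ∫⁻ y, ENNReal.ofReal (heatKernel d a (x - w)) *
        ENNReal.ofReal (heatKernel d b (w - y)) * g y := by
    intro w
    rw [← lintegral_const_mul' _ _ ENNReal.ofReal_ne_top]
    simp_rw [mul_assoc]
  simp_rw [h1]
  rw [lintegral_lintegral_swap]
  · congr 1 with y
    have h2 : Measurable fun w => ENNReal.ofReal (heatKernel d a (x - w)) *
        ENNReal.ofReal (heatKernel d b (w - y)) := by fun_prop
    rw [lintegral_mul_const _ h2, lintegral_heatKernel_mul_heatKernel ha hb]
  · have h2 : Measurable fun p : 𝔼 × 𝔼 => ENNReal.ofReal (heatKernel d a (x - p.1)) *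
        ENNReal.ofReal (heatKernel d b (p.1 - p.2)) * g p.2 := by fun_prop
    exact h2.aemeasurable

variable {V : Type*} [NormedAddCommGroup V] [InnerProductSpace ℝ V]

lemma integrable_heatKernel_smul {t : ℝ} (ht : 0 < t) {h : 𝔼 → V} (hm : StronglyMeasurable h)
    {B : ℝ} (hB : ∀ y, ‖h y‖ ≤ B) (x : 𝔼) :
    Integrable (fun y => heatKernel d t (x - y) • h y) := by
  refine ((integrable_heatKernel_sub ht x).mul_const B).mono'
    ((integrable_heatKernel_sub ht x).aestronglyMeasurable.smul hm.aestronglyMeasurable)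
    (Filter.Eventually.of_forall fun y => ?_)
  rw [norm_smul, Real.norm_of_nonneg (heatKernel_pos ht _).le]
  exact mul_le_mul_of_nonneg_left (hB y) (heatKernel_pos ht _).le

variable [CompleteSpace V]

lemma heatOp_eq (t : ℝ) (h : 𝔼 → V) (x : 𝔼) :
    heatOp d t h x = ∫ y, heatKernel d t (x - y) • h y := by
  unfold heatOp
  rw [← integral_sub_left_eq_self _ volume x]
  simp

lemma norm_heatOp_le {t : ℝ} (ht : 0 < t) {h : 𝔼 → V} {B : ℝ} (hB : ∀ y, ‖h y‖ ≤ B) (x : 𝔼) :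
    ‖heatOp d t h x‖ ≤ B := by
  rw [heatOp_eq]
  calc ‖∫ y, heatKernel d t (x - y) • h y‖
      ≤ ∫ y, heatKernel d t (x - y) * B := by
        refine norm_integral_le_of_norm_le ((integrable_heatKernel_sub ht x).mul_const B)
          (Filter.Eventually.of_forall fun y => ?_)
        rw [norm_smul, Real.norm_of_nonneg (heatKernel_pos ht _).le]
        exact mul_le_mul_of_nonneg_left (hB y) (heatKernel_pos ht _).le
    _ = B := by rw [integral_mul_const, integral_heatKernel_sub ht, one_mul]

lemma stronglyMeasurable_heatOp {P : Type*} [MeasurableSpace P] {h : P → 𝔼 → V}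
    (hh : StronglyMeasurable (Function.uncurry h)) :
    StronglyMeasurable (fun q : (P × ℝ) × 𝔼 => heatOp d q.1.2 (h q.1.1) q.2) := by
  simp_rw [heatOp_eq]
  refine StronglyMeasurable.integral_prod_right' (f := fun r : ((P × ℝ) × 𝔼) × 𝔼 =>
    heatKernel d r.1.1.2 (r.1.2 - r.2) • h r.1.1.1 r.2) ?_
  refine StronglyMeasurable.smul ?_ ?_
  · exact (measurable_heatKernel_uncurry.comp (measurable_fst.fst.snd.prodMk
      (measurable_fst.snd.sub measurable_snd))).stronglyMeasurable
  · exact hh.comp_measurable (measurable_fst.fst.fst.prodMk measurable_snd)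

lemma stronglyMeasurable_heatOp_uncurry {h : 𝔼 → V} (hh : StronglyMeasurable h) :
    StronglyMeasurable (fun q : ℝ × 𝔼 => heatOp d q.1 h q.2) := by
  have := stronglyMeasurable_heatOp (d := d) (P := Unit) (h := fun _ => h)
    (hh.comp_measurable measurable_snd)
  exact this.comp_measurable (g := fun q : ℝ × 𝔼 => (((), q.1), q.2)) (by fun_prop)

lemma heatOp_heatOp {a b : ℝ} (ha : 0 < a) (hb : 0 < b) {h : 𝔼 → V} (hh : StronglyMeasurable h)
    {B : ℝ} (hB : ∀ y, ‖h y‖ ≤ B) (x : 𝔼) :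
    heatOp d a (heatOp d b h) x = heatOp d (a + b) h x := by
  have hB0 : 0 ≤ B := (norm_nonneg _).trans (hB 0)
  rw [heatOp_eq, heatOp_eq]
  simp_rw [heatOp_eq, ← integral_smul]
  rw [integral_integral_swap]
  · congr 1 with y
    simp_rw [smul_smul]
    rw [integral_smul_const, integral_heatKernel_mul_heatKernel ha hb]
  · have hm (t : ℝ) : Measurable (fun p : 𝔼 × 𝔼 => heatKernel d t (p.1 - p.2)) :=
      (continuous_heatKernel t).measurable.comp (measurable_fst.sub measurable_snd)
    have hm' : AEStronglyMeasurable (Function.uncurry fun w y =>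
        heatKernel d a (x - w) • heatKernel d b (w - y) • h y) (volume.prod volume) := by
      refine StronglyMeasurable.aestronglyMeasurable ?_
      exact (((hm a).comp (measurable_const.prodMk measurable_fst)).stronglyMeasurable).smul
        ((hm b).stronglyMeasurable.smul (hh.comp_measurable measurable_snd))
    rw [integrable_prod_iff hm']
    refine ⟨Filter.Eventually.of_forall fun w => ?_, ?_⟩
    · exact (integrable_heatKernel_smul hb hh hB w).smul (heatKernel d a (x - w))
    · refine ((integrable_heatKernel_sub ha x).mul_const B).mono'
        hm'.norm.integral_prod_right' (Filter.Eventually.of_forall fun w => ?_)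
      rw [Real.norm_of_nonneg (integral_nonneg fun y => norm_nonneg _)]
      simp only [Function.uncurry_apply_pair, norm_smul,
        Real.norm_of_nonneg (heatKernel_pos ha _).le, Real.norm_of_nonneg (heatKernel_pos hb _).le]
      rw [integral_const_mul]
      refine mul_le_mul_of_nonneg_left ?_ (heatKernel_pos ha _).le
      calc ∫ y, heatKernel d b (w - y) * ‖h y‖ ≤ ∫ y, heatKernel d b (w - y) * B := by
            refine integral_mono_of_nonneg (Filter.Eventually.of_forall fun y =>
              mul_nonneg (heatKernel_pos hb _).le (norm_nonneg _))
              ((integrable_heatKernel_sub hb w).mul_const B)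
              (Filter.Eventually.of_forall fun y =>
                mul_le_mul_of_nonneg_left (hB y) (heatKernel_pos hb _).le)
        _ = B := by rw [integral_mul_const, integral_heatKernel_sub hb, one_mul]

end HeatOp

lemma stronglyMeasurable_pi_of_forall {α ι β : Type*} [MeasurableSpace α] [Fintype ι]
    [AddCommMonoid β] [TopologicalSpace β] [ContinuousAdd β] {g : α → ι → β}
    (hg : ∀ i, StronglyMeasurable fun a => g a i) : StronglyMeasurable g := by
  classical
  have h : g = fun a => ∑ i, Pi.single i (g a i) := by
    ext1 a
    exact (Finset.univ_sum_single (g a)).symm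
  rw [h]
  exact Finset.stronglyMeasurable_fun_sum _ fun i _ =>
    (continuous_single i).comp_stronglyMeasurable (hg i)

section Gradient

variable {d : ℕ}

local notation "𝔼" => EuclideanSpace ℝ (Fin d)

/-- The `j`-th partial derivative of the heat kernel. -/
noncomputable def heatKernelDeriv (d : ℕ) (j : Fin d) (t : ℝ) (z : EuclideanSpace ℝ (Fin d)) : ℝ :=
  -(z j / (2 * t)) * heatKernel d t z

lemma measurable_heatKernelDeriv_uncurry (j : Fin d) :
    Measurable (fun p : ℝ × 𝔼 => heatKernelDeriv d j p.1 p.2) := by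
  unfold heatKernelDeriv
  have := measurable_heatKernel_uncurry (d := d)
  fun_prop

lemma continuous_heatKernelDeriv (j : Fin d) (t : ℝ) : Continuous (heatKernelDeriv d j t) := by
  unfold heatKernelDeriv
  have := continuous_heatKernel (d := d) t
  fun_prop

lemma hasFDerivAt_heatKernel {t : ℝ} (z : 𝔼) :
    HasFDerivAt (heatKernel d t) ((-(1 / (2 * t)) * heatKernel d t z) • innerSL ℝ z) z := by
  have h1 : HasFDerivAt (fun z : 𝔼 => ‖z‖ ^ 2) (2 • innerSL ℝ z) z :=
    (hasStrictFDerivAt_norm_sq z).hasFDerivAt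
  have h2 := ((h1.neg.mul_const (4 * t)⁻¹).exp).const_mul ((4 * Real.pi * t) ^ (-(d : ℝ) / 2))
  refine (h2.congr_fderiv ?_).congr_of_eventuallyEq (Filter.Eventually.of_forall fun y => ?_)
  · ext v
    simp only [smul_apply, neg_apply, smul_eq_mul,
      nsmul_eq_mul, heatKernel, div_eq_mul_inv, mul_inv, Pi.neg_apply]
    simp
    ring
  · simp [heatKernel, div_eq_mul_inv]

lemma norm_mul_heatKernel_le {t : ℝ} (ht : 0 < t) (z : 𝔼) :
    ‖z‖ * heatKernel d t z ≤
      heatKernel d t z + 4 * t * ((2 : ℝ) ^ ((d : ℝ) / 2) * heatKernel d (2 * t) z) := by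
  have h := sq_norm_mul_heatKernel_le ht z
  rw [div_mul_eq_mul_div, div_le_iff₀ (by positivity)] at h
  nlinarith [heatKernel_pos ht z, sq_nonneg (‖z‖ - 1),
    mul_nonneg (sq_nonneg (‖z‖ - 1)) (heatKernel_pos ht z).le, sq_nonneg ‖z‖,
    mul_nonneg (norm_nonneg z) (heatKernel_pos ht z).le]

lemma exists_integrable_bound_norm_mul_heatKernel {t : ℝ} (ht : 0 < t) (x₀ : 𝔼) :
    ∃ b : 𝔼 → ℝ, Integrable b ∧
      ∀ x ∈ Metric.ball x₀ 1, ∀ y, ‖x - y‖ * heatKernel d t (x - y) ≤ b y := by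
  refine ⟨fun y => Real.exp (1 / t / 4) * ((2 : ℝ) ^ ((d : ℝ) / 2) * heatKernel d (2 * t) (x₀ - y))
      + 4 * t * ((2 : ℝ) ^ ((d : ℝ) / 2) * (Real.exp (1 / (2 * t) / 4) *
        ((2 : ℝ) ^ ((d : ℝ) / 2) * heatKernel d (2 * (2 * t)) (x₀ - y)))), ?_, ?_⟩
  · exact (((integrable_heatKernel_sub (by positivity) x₀).const_mul _).const_mul _).add
      ((((((integrable_heatKernel_sub (by positivity) x₀).const_mul _).const_mul _).const_mul
        _).const_mul _))
  · intro x hx y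
    have h1 : ‖x - y - (x₀ - y)‖ ^ 2 ≤ 1 := by
      rw [sub_sub_sub_cancel_right, ← dist_eq_norm]
      have := Metric.mem_ball.1 hx
      nlinarith [dist_nonneg (x := x) (y := x₀)]
    refine (norm_mul_heatKernel_le ht _).trans (add_le_add ?_ ?_)
    · exact heatKernel_le_of_near ht (by rwa [one_div_mul_cancel ht.ne'])
    · gcongr
      exact heatKernel_le_of_near (by positivity) (by rwa [one_div_mul_cancel (by positivity)])

variable {V : Type*} [NormedAddCommGroup V] [InnerProductSpace ℝ V]

lemma integrable_heatKernelDeriv {t : ℝ} (ht : 0 < t) (j : Fin d) (x : 𝔼) :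
    Integrable (fun y => heatKernelDeriv d j t (x - y)) := by
  obtain ⟨b, hb, hb'⟩ := exists_integrable_bound_norm_mul_heatKernel ht x
  refine (hb.const_mul (1 / (2 * t))).mono'
    (((continuous_heatKernelDeriv j t).comp (continuous_const.sub
      continuous_id)).aestronglyMeasurable) (Filter.Eventually.of_forall fun y => ?_)
  rw [heatKernelDeriv, norm_mul, norm_neg, norm_div, Real.norm_of_nonneg (heatKernel_pos ht _).le,
    Real.norm_of_nonneg (by positivity : 0 ≤ 2 * t)]
  calc ‖(x - y) j‖ / (2 * t) * heatKernel d t (x - y)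
      ≤ ‖x - y‖ / (2 * t) * heatKernel d t (x - y) := by
        have := (heatKernel_pos ht (x - y)).le
        gcongr
        exact PiLp.norm_apply_le _ _
    _ = 1 / (2 * t) * (‖x - y‖ * heatKernel d t (x - y)) := by ring
    _ ≤ 1 / (2 * t) * b y := by
        gcongr
        exact hb' x (Metric.mem_ball_self one_pos) y

lemma integrable_heatKernelDeriv_smul {t : ℝ} (ht : 0 < t) {h : 𝔼 → V}
    (hm : StronglyMeasurable h) {B : ℝ} (hB : ∀ y, ‖h y‖ ≤ B) (j : Fin d) (x : 𝔼) :
    Integrable (fun y => heatKernelDeriv d j t (x - y) • h y) := by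
  refine ((integrable_heatKernelDeriv ht j x).norm.mul_const B).mono'
    ((integrable_heatKernelDeriv ht j x).aestronglyMeasurable.smul hm.aestronglyMeasurable)
    (Filter.Eventually.of_forall fun y => ?_)
  rw [norm_smul]
  exact mul_le_mul_of_nonneg_left (hB y) (norm_nonneg _)

/-- The spatial gradient of `T_t h`, written with the derivatives falling on the heat kernel. -/
noncomputable def heatGrad (d : ℕ) {V : Type*} [NormedAddCommGroup V] [InnerProductSpace ℝ V]
    (t : ℝ) (h : EuclideanSpace ℝ (Fin d) → V) (x : EuclideanSpace ℝ (Fin d)) :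
    PiLp 2 (fun _ : Fin d => V) :=
  WithLp.toLp 2 fun j => ∫ y, heatKernelDeriv d j t (x - y) • h y

lemma heatGrad_apply (t : ℝ) (h : 𝔼 → V) (x : 𝔼) (j : Fin d) :
    heatGrad d t h x j = ∫ y, heatKernelDeriv d j t (x - y) • h y := rfl

lemma stronglyMeasurable_heatGrad {P : Type*} [MeasurableSpace P] {h : P → 𝔼 → V}
    (hh : StronglyMeasurable (Function.uncurry h)) :
    StronglyMeasurable (fun q : (P × ℝ) × 𝔼 => heatGrad d q.1.2 (h q.1.1) q.2) := by
  unfold heatGrad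
  refine (PiLp.continuous_toLp 2 _).comp_stronglyMeasurable
    (stronglyMeasurable_pi_of_forall fun j => ?_)
  refine StronglyMeasurable.integral_prod_right' (f := fun r : ((P × ℝ) × 𝔼) × 𝔼 =>
    heatKernelDeriv d j r.1.1.2 (r.1.2 - r.2) • h r.1.1.1 r.2) ?_
  refine StronglyMeasurable.smul ?_ ?_
  · exact ((measurable_heatKernelDeriv_uncurry j).comp (measurable_fst.fst.snd.prodMk
      (measurable_fst.snd.sub measurable_snd))).stronglyMeasurable
  · exact hh.comp_measurable (measurable_fst.fst.fst.prodMk measurable_snd)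

lemma stronglyMeasurable_heatGrad_uncurry {h : 𝔼 → V} (hh : StronglyMeasurable h) :
    StronglyMeasurable (fun q : ℝ × 𝔼 => heatGrad d q.1 h q.2) := by
  have := stronglyMeasurable_heatGrad (d := d) (P := Unit) (h := fun _ => h)
    (hh.comp_measurable measurable_snd)
  exact this.comp_measurable (g := fun q : ℝ × 𝔼 => (((), q.1), q.2)) (by fun_prop)

variable [CompleteSpace V]

lemma fderiv_heatOp {t : ℝ} (ht : 0 < t) {h : 𝔼 → V} (hm : StronglyMeasurable h)
    {B : ℝ} (hB : ∀ y, ‖h y‖ ≤ B) (x : 𝔼) (j : Fin d) :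
    fderiv ℝ (heatOp d t h) x (EuclideanSpace.single j 1) = heatGrad d t h x j := by
  have hB0 : 0 ≤ B := (norm_nonneg _).trans (hB 0)
  obtain ⟨b, hb, hb'⟩ := exists_integrable_bound_norm_mul_heatKernel ht x
  set F' : 𝔼 → 𝔼 → 𝔼 →L[ℝ] V := fun x y =>
    ((-(1 / (2 * t)) * heatKernel d t (x - y)) • innerSL ℝ (x - y)).smulRight (h y) with hF'
  have hF'eq : ∀ x y, F' x y = (-(1 / (2 * t)) * heatKernel d t (x - y)) •
      ContinuousLinearMap.smulRightL ℝ 𝔼 V (innerSL ℝ (x - y)) (h y) := by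
    intro x y
    ext v
    simp [hF', smul_smul, ← sub_smul]
  have hF'm : AEStronglyMeasurable (F' x) volume := by
    have h1 : F' x = fun y => _ := funext fun y => hF'eq x y
    rw [h1]
    have h2 : Continuous fun p : 𝔼 × V =>
        ContinuousLinearMap.smulRightL ℝ 𝔼 V (innerSL ℝ (x - p.1)) p.2 := by fun_prop
    have h3 : StronglyMeasurable fun y => ContinuousLinearMap.smulRightL ℝ 𝔼 V
        (innerSL ℝ (x - y)) (h y) :=
      h2.comp_stronglyMeasurable (f := fun y => (y, h y)) (stronglyMeasurable_id.prodMk hm)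
    have h4 : StronglyMeasurable fun y => -(1 / (2 * t)) * heatKernel d t (x - y) := by
      have := continuous_heatKernel (d := d) t
      exact Continuous.stronglyMeasurable (by fun_prop)
    exact (h4.smul h3).aestronglyMeasurable
  have hbound : ∀ x' ∈ Metric.ball x 1, ∀ y, ‖F' x' y‖ ≤ 1 / (2 * t) * b y * B := by
    intro x' hx' y
    rw [hF', ContinuousLinearMap.norm_smulRight_apply, norm_smul, innerSL_apply_norm, norm_mul,
      norm_neg, Real.norm_of_nonneg (by positivity : 0 ≤ 1 / (2 * t)),
      Real.norm_of_nonneg (heatKernel_pos ht _).le]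
    have h3 := hb' x' hx' y
    have h4 : 0 ≤ b y := le_trans
      (mul_nonneg (norm_nonneg _) (heatKernel_pos ht _).le) h3
    have h5 := hB y
    calc 1 / (2 * t) * heatKernel d t (x' - y) * ‖x' - y‖ * ‖h y‖
        = 1 / (2 * t) * (‖x' - y‖ * heatKernel d t (x' - y)) * ‖h y‖ := by ring
      _ ≤ 1 / (2 * t) * b y * B := by gcongr
  have key : HasFDerivAt (fun x => ∫ y, heatKernel d t (x - y) • h y) (∫ y, F' x y) x := by
    refine hasFDerivAt_integral_of_dominated_of_fderiv_le (𝕜 := ℝ)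
      (bound := fun y => 1 / (2 * t) * b y * B) (F' := F')
      (Metric.ball_mem_nhds x one_pos)
      (Filter.Eventually.of_forall fun x' =>
        (integrable_heatKernel_smul ht hm hB x').aestronglyMeasurable)
      (integrable_heatKernel_smul ht hm hB x) hF'm
      (Filter.Eventually.of_forall fun y x' hx' => hbound x' hx' y)
      ((hb.const_mul _).mul_const B)
      (Filter.Eventually.of_forall fun y x' _ => ?_)
    have := (hasFDerivAt_heatKernel (t := t) (x' - y)).comp x' ((hasFDerivAt_id x').sub_const y)
    rw [ContinuousLinearMap.comp_id] at this
    exact this.smul_const (h y)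
  have heq : heatOp d t h = fun x => ∫ y, heatKernel d t (x - y) • h y := by
    ext x
    rw [heatOp_eq]
  have hF'int : Integrable (F' x) := ((hb.const_mul (1 / (2 * t))).mul_const B).mono' hF'm
    (Filter.Eventually.of_forall fun y => hbound x (Metric.mem_ball_self one_pos) y)
  rw [heq, key.fderiv, ContinuousLinearMap.integral_apply hF'int, heatGrad_apply]
  congr 1 with y
  simp [hF', heatKernelDeriv, EuclideanSpace.inner_single_right]
  congr 1
  ring

lemma gradHeatNormSq_eq {t : ℝ} (ht : 0 < t) {h : 𝔼 → V} (hm : StronglyMeasurable h)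
    {B : ℝ} (hB : ∀ y, ‖h y‖ ≤ B) (x : 𝔼) :
    gradHeatNormSq d t h x = ‖heatGrad d t h x‖ ^ 2 := by
  rw [PiLp.norm_sq_eq_of_L2, gradHeatNormSq]
  simp_rw [fderiv_heatOp ht hm hB]

end Gradient

section Variance

variable {V : Type*} [NormedAddCommGroup V] [InnerProductSpace ℝ V]

/-- The variance identity `E‖v - E v‖² + ‖E v‖² = E‖v‖²`. -/
lemma lintegral_enorm_sub_integral_sq_add [CompleteSpace V] {Ω : Type*} [MeasurableSpace Ω] {μ : Measure Ω}
    [IsProbabilityMeasure μ] {v : Ω → V} (hv : StronglyMeasurable v) {B : ℝ}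
    (hB : ∀ y, ‖v y‖ ≤ B) :
    ∫⁻ y, ‖v y - ∫ z, v z ∂μ‖ₑ ^ 2 ∂μ + ‖∫ z, v z ∂μ‖ₑ ^ 2 = ∫⁻ y, ‖v y‖ₑ ^ 2 ∂μ := by
  set a := ∫ z, v z ∂μ with ha
  have hvi : Integrable v μ := .of_bound hv.aestronglyMeasurable B (.of_forall hB)
  have hv2 : Integrable (fun y => ‖v y‖ ^ 2) μ := by
    refine .of_bound (hv.norm.pow 2).aestronglyMeasurable (B ^ 2) (.of_forall fun y => ?_)
    rw [norm_pow, norm_norm]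
    exact pow_le_pow_left₀ (norm_nonneg _) (hB y) 2
  have hexp : ∀ y, ‖v y - a‖ ^ 2 = ‖v y‖ ^ 2 - 2 * inner ℝ a (v y) + ‖a‖ ^ 2 := by
    intro y
    rw [norm_sub_sq_real, real_inner_comm]
  have hin : Integrable (fun y => 2 * inner ℝ a (v y)) μ := (hvi.const_inner a).const_mul 2
  have hsub : Integrable (fun y => ‖v y‖ ^ 2 - 2 * inner ℝ a (v y)) μ := hv2.sub hin
  have hva : Integrable (fun y => ‖v y - a‖ ^ 2) μ := by
    simp_rw [hexp]
    exact hsub.add (integrable_const _)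
  have hreal : ∫ y, ‖v y - a‖ ^ 2 ∂μ + ‖a‖ ^ 2 = ∫ y, ‖v y‖ ^ 2 ∂μ := by
    simp_rw [hexp]
    rw [integral_add hsub (integrable_const _), integral_sub hv2 hin,
      integral_const_mul, integral_inner hvi, ← ha, real_inner_self_eq_norm_sq]
    simp
    ring
  have hconv : ∀ w : V, ‖w‖ₑ ^ 2 = ENNReal.ofReal (‖w‖ ^ 2) := by
    intro w
    rw [ENNReal.ofReal_pow (norm_nonneg _), ofReal_norm]
  simp_rw [hconv]
  rw [← ofReal_integral_eq_lintegral_ofReal hv2 (.of_forall fun y => by positivity),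
    ← ofReal_integral_eq_lintegral_ofReal hva (.of_forall fun y => by positivity), ← hreal,
    ENNReal.ofReal_add (integral_nonneg fun y => by positivity) (by positivity)]

lemma enorm_integral_smul_sq_le {Ω : Type*} [MeasurableSpace Ω] {μ : Measure Ω}
    {κ : Ω → ℝ} (hκ : Measurable κ) {v : Ω → V} (hv : StronglyMeasurable v) :
    ‖∫ y, κ y • v y ∂μ‖ₑ ^ 2 ≤ (∫⁻ y, ‖κ y‖ₑ ^ 2 ∂μ) * ∫⁻ y, ‖v y‖ₑ ^ 2 ∂μ := by
  have h1 : ‖∫ y, κ y • v y ∂μ‖ₑ ≤ ∫⁻ y, ‖κ y‖ₑ * ‖v y‖ₑ ∂μ := by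
    refine (enorm_integral_le_lintegral_enorm _).trans_eq ?_
    simp_rw [enorm_smul]
  have h2 := ENNReal.lintegral_mul_le_Lp_mul_Lq μ (p := 2) (q := 2)
    (by rw [Real.holderConjugate_iff]; norm_num) hκ.enorm.aemeasurable hv.enorm.aemeasurable
  have h3 := h1.trans h2
  calc _ ≤ _ := pow_le_pow_left₀ zero_le h3 2
    _ = _ := by
      rw [mul_pow, ← ENNReal.rpow_natCast, ← ENNReal.rpow_natCast, ← ENNReal.rpow_mul,
        ← ENNReal.rpow_mul]
      norm_num

end Variance

section Energy

variable {d : ℕ}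

local notation "𝔼" => EuclideanSpace ℝ (Fin d)

lemma integral_heatKernelDeriv_sub (t : ℝ) (j : Fin d) (x : 𝔼) :
    ∫ y, heatKernelDeriv d j t (x - y) = 0 := by
  rw [integral_sub_left_eq_self (heatKernelDeriv d j t)]
  have h1 := integral_neg_eq_self (heatKernelDeriv d j t) volume
  have h2 : ∀ z, heatKernelDeriv d j t (-z) = -heatKernelDeriv d j t z := by
    intro z
    simp only [heatKernelDeriv, heatKernel_neg, PiLp.neg_apply]
    ring
  simp_rw [h2] at h1
  rw [integral_neg] at h1
  linarith

lemma lintegral_heatKernel_mul_deriv_sq_le {t : ℝ} (ht : 0 < t) (j : Fin d) (x : 𝔼) :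
    ∫⁻ y, ENNReal.ofReal (heatKernel d t (x - y)) * ‖-((x - y) j / (2 * t))‖ₑ ^ 2 ≤
      ENNReal.ofReal ((2 : ℝ) ^ ((d : ℝ) / 2) / t) := by
  calc _ ≤ ∫⁻ y, ENNReal.ofReal ((2 : ℝ) ^ ((d : ℝ) / 2) / t) *
        ENNReal.ofReal (heatKernel d (2 * t) (x - y)) := by
        refine lintegral_mono fun y => ?_
        rw [← ofReal_norm, ← ENNReal.ofReal_pow (norm_nonneg _),
          ← ENNReal.ofReal_mul (heatKernel_pos ht _).le, ← ENNReal.ofReal_mul (by positivity)]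
        refine ENNReal.ofReal_le_ofReal ?_
        have h1 := sq_norm_mul_heatKernel_le ht (x - y)
        have h2 : (x - y) j ^ 2 ≤ ‖x - y‖ ^ 2 := by
          rw [← sq_abs, ← Real.norm_eq_abs]
          exact pow_le_pow_left₀ (norm_nonneg _) (PiLp.norm_apply_le _ _) 2
        rw [norm_neg, Real.norm_eq_abs, sq_abs]
        calc heatKernel d t (x - y) * ((x - y) j / (2 * t)) ^ 2
            = (1 / t) * ((x - y) j ^ 2 / (4 * t) * heatKernel d t (x - y)) := by
              field_simp
              ring
          _ ≤ (1 / t) * (‖x - y‖ ^ 2 / (4 * t) * heatKernel d t (x - y)) := by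
              have := (heatKernel_pos ht (x - y)).le
              gcongr
          _ ≤ (1 / t) * ((2 : ℝ) ^ ((d : ℝ) / 2) * heatKernel d (2 * t) (x - y)) := by gcongr
          _ = _ := by ring
    _ = _ := by
        rw [lintegral_const_mul' _ _ ENNReal.ofReal_ne_top, lintegral_heatKernel_sub (by positivity),
          mul_one]

variable {V : Type*} [NormedAddCommGroup V] [InnerProductSpace ℝ V] [CompleteSpace V]

/-- A Poincaré-type bound: the gradient of `T_t v` is controlled by the variance of `v` under
the heat kernel measure. -/
lemma enorm_heatGrad_apply_sq_add_le {t : ℝ} (ht : 0 < t) {v : 𝔼 → V}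
    (hv : StronglyMeasurable v) {B : ℝ} (hB : ∀ y, ‖v y‖ ≤ B) (x : 𝔼) (j : Fin d) :
    ENNReal.ofReal t * ‖heatGrad d t v x j‖ₑ ^ 2 +
        ENNReal.ofReal ((2 : ℝ) ^ ((d : ℝ) / 2)) * ‖heatOp d t v x‖ₑ ^ 2 ≤
      ENNReal.ofReal ((2 : ℝ) ^ ((d : ℝ) / 2)) * heatLint d t (fun y => ‖v y‖ₑ ^ 2) x := by
  have hk : Measurable (heatKernel d t) := (continuous_heatKernel t).measurable
  have hkx : Measurable fun y => ENNReal.ofReal (heatKernel d t (x - y)) := by fun_prop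
  set μ : Measure 𝔼 := volume.withDensity fun y => ENNReal.ofReal (heatKernel d t (x - y)) with hμ
  have hprob : IsProbabilityMeasure μ := by
    refine ⟨?_⟩
    rw [hμ, withDensity_apply _ MeasurableSet.univ, Measure.restrict_univ,
      lintegral_heatKernel_sub ht]
  have hlint : ∀ g : 𝔼 → ℝ≥0∞, Measurable g →
      ∫⁻ y, g y ∂μ = ∫⁻ y, ENNReal.ofReal (heatKernel d t (x - y)) * g y := fun g hg => by
    rw [hμ, lintegral_withDensity_eq_lintegral_mul _ hkx hg]
    rfl
  have hint : ∀ g : 𝔼 → V, ∫ y, g y ∂μ = ∫ y, heatKernel d t (x - y) • g y := fun g => by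
    rw [hμ, integral_withDensity_eq_integral_toReal_smul hkx (.of_forall fun y => by simp)]
    simp_rw [ENNReal.toReal_ofReal (heatKernel_pos ht _).le]
  set κ : 𝔼 → ℝ := fun y => -((x - y) j / (2 * t)) with hκ
  have hκm : Measurable κ := by fun_prop
  have ha : ∫ y, v y ∂μ = heatOp d t v x := by rw [hint, heatOp_eq]
  set a := heatOp d t v x with hadef
  have hgrad : heatGrad d t v x j = ∫ y, κ y • (v y - a) ∂μ := by
    have h1 : ∀ y, heatKernel d t (x - y) • κ y • (v y - a) =
        heatKernelDeriv d j t (x - y) • v y - heatKernelDeriv d j t (x - y) • a := by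
      intro y
      rw [smul_smul, ← smul_sub]
      congr 1
      simp only [hκ, heatKernelDeriv]
      ring
    rw [hint]
    simp_rw [h1]
    rw [integral_sub (integrable_heatKernelDeriv_smul ht hv hB j x)
      ((integrable_heatKernelDeriv ht j x).smul_const a), integral_smul_const,
      integral_heatKernelDeriv_sub, zero_smul, sub_zero, heatGrad_apply]
  have hvar := lintegral_enorm_sub_integral_sq_add (μ := μ) hv hB
  rw [ha] at hvar
  have hva : StronglyMeasurable fun y => v y - a := hv.sub stronglyMeasurable_const
  have hCS := enorm_integral_smul_sq_le (μ := μ) hκm hva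
  have hκ2 : ∫⁻ y, ‖κ y‖ₑ ^ 2 ∂μ ≤ ENNReal.ofReal ((2 : ℝ) ^ ((d : ℝ) / 2) / t) := by
    rw [hlint _ (by fun_prop)]
    exact lintegral_heatKernel_mul_deriv_sq_le ht j x
  have hv2 : heatLint d t (fun y => ‖v y‖ₑ ^ 2) x = ∫⁻ y, ‖v y‖ₑ ^ 2 ∂μ := by
    rw [hlint _ (hv.enorm.pow_const 2)]
    rfl
  rw [hv2, ← hvar, mul_add, hgrad]
  refine add_le_add ?_ le_rfl
  calc _ ≤ ENNReal.ofReal t * (ENNReal.ofReal ((2 : ℝ) ^ ((d : ℝ) / 2) / t) *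
        ∫⁻ y, ‖v y - a‖ₑ ^ 2 ∂μ) := by
        gcongr
        exact hCS.trans (by gcongr)
    _ = _ := by
        rw [← mul_assoc, ← ENNReal.ofReal_mul ht.le, mul_div_cancel₀ _ ht.ne']

/-- The constant in the gradient–variance inequality. -/
noncomputable def varConst (d : ℕ) : ℝ := d * (2 : ℝ) ^ ((d : ℝ) / 2)

lemma enorm_heatGrad_sq (t : ℝ) (v : 𝔼 → V) (x : 𝔼) :
    ‖heatGrad d t v x‖ₑ ^ 2 = ∑ j, ‖heatGrad d t v x j‖ₑ ^ 2 := by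
  simp_rw [← ofReal_norm, ← ENNReal.ofReal_pow (norm_nonneg _)]
  rw [PiLp.norm_sq_eq_of_L2, ENNReal.ofReal_sum_of_nonneg fun j _ => by positivity]

lemma enorm_heatGrad_sq_add_le {t : ℝ} (ht : 0 < t) {v : 𝔼 → V}
    (hv : StronglyMeasurable v) {B : ℝ} (hB : ∀ y, ‖v y‖ ≤ B) (x : 𝔼) :
    ENNReal.ofReal t * ‖heatGrad d t v x‖ₑ ^ 2 +
        ENNReal.ofReal (varConst d) * ‖heatOp d t v x‖ₑ ^ 2 ≤
      ENNReal.ofReal (varConst d) * heatLint d t (fun y => ‖v y‖ₑ ^ 2) x := by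
  have h := Finset.sum_le_sum fun (j : Fin d) (_ : j ∈ Finset.univ) =>
    enorm_heatGrad_apply_sq_add_le ht hv hB x j
  rw [Finset.sum_add_distrib, ← Finset.mul_sum, ← enorm_heatGrad_sq, Finset.sum_const,
    Finset.sum_const, Finset.card_univ, Fintype.card_fin, nsmul_eq_mul, nsmul_eq_mul,
    ← mul_assoc, ← mul_assoc] at h
  rwa [varConst, ENNReal.ofReal_mul (by positivity), ENNReal.ofReal_natCast]

lemma enorm_heatOp_sq_le (hd : 1 ≤ d) {t : ℝ} (ht : 0 < t) {v : 𝔼 → V}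
    (hv : StronglyMeasurable v) {B : ℝ} (hB : ∀ y, ‖v y‖ ≤ B) (x : 𝔼) :
    ‖heatOp d t v x‖ₑ ^ 2 ≤ heatLint d t (fun y => ‖v y‖ₑ ^ 2) x := by
  have h := le_trans le_add_self (enorm_heatGrad_apply_sq_add_le ht hv hB x ⟨0, hd⟩)
  have hc : 0 < (2 : ℝ) ^ ((d : ℝ) / 2) := by positivity
  exact (ENNReal.mul_le_mul_iff_right (ENNReal.ofReal_pos.2 hc).ne' ENNReal.ofReal_ne_top).1 h

lemma heatGrad_heatOp {a b : ℝ} (ha : 0 < a) (hb : 0 < b) {h : 𝔼 → V} (hh : StronglyMeasurable h)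
    {B : ℝ} (hB : ∀ y, ‖h y‖ ≤ B) (x : 𝔼) :
    heatGrad d a (heatOp d b h) x = heatGrad d (a + b) h x := by
  have hm : StronglyMeasurable (heatOp d b h) :=
    (stronglyMeasurable_heatOp_uncurry hh).comp_measurable measurable_prodMk_left
  have he : heatOp d a (heatOp d b h) = heatOp d (a + b) h :=
    funext fun y => heatOp_heatOp ha hb hh hB y
  ext j
  rw [← fderiv_heatOp ha hm (norm_heatOp_le hb hB), ← fderiv_heatOp (add_pos ha hb) hh hB, he]

end Energy

section EnergyIntegral

variable {d : ℕ}

local notation "𝔼" => EuclideanSpace ℝ (Fin d)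

lemma heatLint_add (t : ℝ) {g g' : 𝔼 → ℝ≥0∞} (hg : Measurable g) (x : 𝔼) :
    heatLint d t (fun y => g y + g' y) x = heatLint d t g x + heatLint d t g' x := by
  have hk : Measurable (heatKernel d t) := (continuous_heatKernel t).measurable
  unfold heatLint
  simp_rw [mul_add]
  exact lintegral_add_left (by fun_prop) _

lemma heatLint_const_mul (t : ℝ) {c : ℝ≥0∞} (hc : c ≠ ∞) (g : 𝔼 → ℝ≥0∞) (x : 𝔼) :
    heatLint d t (fun y => c * g y) x = c * heatLint d t g x := by
  unfold heatLint
  rw [← lintegral_const_mul' _ _ hc]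
  exact lintegral_congr fun y => by ring

lemma measurable_heatLint_left {g : ℝ → 𝔼 → ℝ≥0∞} (hg : Measurable (Function.uncurry g))
    {u : ℝ → ℝ} (hu : Measurable u) (x : 𝔼) :
    Measurable fun τ : ℝ => heatLint d (u τ) (g τ) x := by
  have hg' : Measurable fun p : ℝ × 𝔼 => g p.1 p.2 := hg
  have hk := measurable_heatKernel_uncurry (d := d)
  have h1 : Measurable fun q : ℝ × 𝔼 =>
      ENNReal.ofReal (heatKernel d (u q.1) (x - q.2)) * g q.1 q.2 := by
    have h2 : Measurable fun q : ℝ × 𝔼 => heatKernel d (u q.1) (x - q.2) :=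
      hk.comp ((hu.comp measurable_fst).prodMk (measurable_const.sub measurable_snd))
    exact h2.ennreal_ofReal.mul hg'
  exact h1.lintegral_prod_right'

variable {V : Type*} [NormedAddCommGroup V] [InnerProductSpace ℝ V] [CompleteSpace V]

lemma heatLint_heatGrad_add_le {S τ ε : ℝ} {h : 𝔼 → V} {B : ℝ} (hh : StronglyMeasurable h) (hB : ∀ y, ‖h y‖ ≤ B)
    (hτ : 0 < τ) (hε : 0 < ε) (hS : τ + ε < S) (x : 𝔼) :
    ENNReal.ofReal ε * heatLint d (S - (τ + ε)) (fun w => ‖heatGrad d (τ + ε) h w‖ₑ ^ 2) x +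
      ENNReal.ofReal (varConst d) *
        heatLint d (S - (τ + ε)) (fun w => ‖heatOp d (τ + ε) h w‖ₑ ^ 2) x ≤
      ENNReal.ofReal (varConst d) * heatLint d (S - τ) (fun w => ‖heatOp d τ h w‖ₑ ^ 2) x := by
  have hm : StronglyMeasurable (heatOp d τ h) :=
    (stronglyMeasurable_heatOp_uncurry hh).comp_measurable measurable_prodMk_left
  have hg : StronglyMeasurable (heatGrad d (τ + ε) h) :=
    (stronglyMeasurable_heatGrad_uncurry hh).comp_measurable measurable_prodMk_left
  have hpt : ∀ w, ENNReal.ofReal ε * ‖heatGrad d (τ + ε) h w‖ₑ ^ 2 +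
      ENNReal.ofReal (varConst d) * ‖heatOp d (τ + ε) h w‖ₑ ^ 2 ≤
      ENNReal.ofReal (varConst d) * heatLint d ε (fun w => ‖heatOp d τ h w‖ₑ ^ 2) w := by
    intro w
    have h1 := enorm_heatGrad_sq_add_le hε hm (norm_heatOp_le hτ hB) w
    rwa [heatGrad_heatOp hε hτ hh hB, heatOp_heatOp hε hτ hh hB, add_comm ε τ] at h1
  have h2 := heatLint_mono (S - (τ + ε)) hpt x
  have hgm : Measurable fun w => ENNReal.ofReal ε * ‖heatGrad d (τ + ε) h w‖ₑ ^ 2 :=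
    (hg.enorm.pow_const 2).const_mul _
  rw [heatLint_add _ hgm,
    heatLint_const_mul _ ENNReal.ofReal_ne_top, heatLint_const_mul _ ENNReal.ofReal_ne_top,
    heatLint_const_mul _ ENNReal.ofReal_ne_top,
    heatLint_heatLint (by linarith) hε (hm.enorm.pow_const 2)] at h2
  rwa [show S - (τ + ε) + ε = S - τ by ring] at h2

lemma heatLint_heatOp_le (hd : 1 ≤ d) {S τ : ℝ} {h : 𝔼 → V} {B : ℝ} (hh : StronglyMeasurable h)
    (hB : ∀ y, ‖h y‖ ≤ B) (hτ : 0 < τ) (hS : τ < S) (x : 𝔼) :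
    heatLint d (S - τ) (fun w => ‖heatOp d τ h w‖ₑ ^ 2) x ≤
      heatLint d S (fun w => ‖h w‖ₑ ^ 2) x := by
  refine (heatLint_mono _ (fun w => enorm_heatOp_sq_le hd hτ hh hB w) x).trans_eq ?_
  rw [heatLint_heatLint (by linarith) hτ (hh.enorm.pow_const 2), sub_add_cancel]

lemma heatLint_enorm_sq_lt_top {S B : ℝ} {h : 𝔼 → V} (hS : 0 < S) (hB : ∀ y, ‖h y‖ ≤ B) (x : 𝔼) :
    heatLint d S (fun w => ‖h w‖ₑ ^ 2) x < ∞ := by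
  refine (heatLint_mono (g' := fun _ => ENNReal.ofReal B ^ 2) S (fun w => ?_) x).trans_lt ?_
  · rw [← ofReal_norm]
    gcongr
    exact hB w
  · rw [heatLint_const hS]
    exact ENNReal.pow_lt_top ENNReal.ofReal_lt_top

lemma setLIntegral_Ioo_shift (F : ℝ → ℝ≥0∞) (ε T : ℝ) :
    ∫⁻ τ in Set.Ioo 0 (T - ε), F (τ + ε) = ∫⁻ τ in Set.Ioo ε T, F τ := by
  have h := (measurePreserving_add_right volume ε).setLIntegral_comp_preimage_emb
    (measurableEmbedding_addRight ε) F (Set.Ioo ε T)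
  simpa using h

/-- The energy estimate for the heat flow, tested against a backward heat kernel. -/
lemma lintegral_heatLint_heatGrad_le (hd : 1 ≤ d) {S T : ℝ} (hS : 0 < S) (hT : T ≤ S)
    {h : 𝔼 → V} {B : ℝ} (hh : StronglyMeasurable h) (hB : ∀ y, ‖h y‖ ≤ B) (x : 𝔼) :
    ∫⁻ τ in Set.Ioo 0 T, heatLint d (S - τ) (fun w => ‖heatGrad d τ h w‖ₑ ^ 2) x ≤
      ENNReal.ofReal (varConst d) * heatLint d S (fun w => ‖h w‖ₑ ^ 2) x := by
  set ψ : ℝ → ℝ≥0∞ := fun τ => heatLint d (S - τ) (fun w => ‖heatGrad d τ h w‖ₑ ^ 2) x with hψ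
  set Φ : ℝ → ℝ≥0∞ := fun τ => heatLint d (S - τ) (fun w => ‖heatOp d τ h w‖ₑ ^ 2) x with hΦ
  set M := heatLint d S (fun w => ‖h w‖ₑ ^ 2) x with hM
  set c := ENNReal.ofReal (varConst d) with hc
  have hΦm : Measurable Φ := by
    have h0 : Measurable fun q : ℝ × 𝔼 => ‖heatOp d q.1 h q.2‖ₑ :=
      (stronglyMeasurable_heatOp_uncurry hh).enorm
    exact measurable_heatLint_left (g := fun τ w => ‖heatOp d τ h w‖ₑ ^ 2) (h0.pow_const 2)
      (u := fun τ => S - τ) (by fun_prop) x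
  have hstep : ∀ ε > 0, ∫⁻ τ in Set.Ioo ε T, ψ τ ≤ c * M := by
    intro ε hε
    rcases le_or_gt T ε with hTε | hTε
    · simp [Set.Ioo_eq_empty_of_le hTε]
    have h1 : ∫⁻ τ in Set.Ioo 0 (T - ε), (ENNReal.ofReal ε * ψ (τ + ε) + c * Φ (τ + ε)) ≤
        ∫⁻ τ in Set.Ioo 0 (T - ε), c * Φ τ := by
      refine setLIntegral_mono' measurableSet_Ioo fun τ hτ => ?_
      exact heatLint_heatGrad_add_le hh hB hτ.1 hε (by linarith [hτ.2]) x
    rw [setLIntegral_Ioo_shift (fun τ => ENNReal.ofReal ε * ψ τ + c * Φ τ),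
      lintegral_add_right _ (hΦm.const_mul c), lintegral_const_mul' _ _ ENNReal.ofReal_ne_top] at h1
    have h2 : ∫⁻ τ in Set.Ioo 0 (T - ε), c * Φ τ ≤
        ENNReal.ofReal ε * (c * M) + ∫⁻ τ in Set.Ioo ε T, c * Φ τ := by
      have hsub : Set.Ioo 0 (T - ε) ⊆ Set.Ioc 0 ε ∪ Set.Ioo ε T := by
        intro τ hτ
        rcases le_or_gt τ ε with h | h
        · exact Or.inl ⟨hτ.1, h⟩
        · exact Or.inr ⟨h, by linarith [hτ.2]⟩
      refine (lintegral_mono_set hsub).trans ((lintegral_union_le _ _ _).trans ?_)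
      refine add_le_add ?_ le_rfl
      calc ∫⁻ τ in Set.Ioc 0 ε, c * Φ τ ≤ ∫⁻ τ in Set.Ioc 0 ε, c * M := by
            refine setLIntegral_mono' measurableSet_Ioc fun τ hτ => ?_
            gcongr
            exact heatLint_heatOp_le hd hh hB hτ.1 (by linarith [hτ.2]) x
        _ = _ := by simp [mul_comm]
    have hfin : ∫⁻ τ in Set.Ioo ε T, c * Φ τ ≠ ∞ := by
      refine ne_top_of_le_ne_top (b := ∫⁻ τ in Set.Ioo ε T, c * M) ?_ ?_
      · rw [setLIntegral_const]
        refine ENNReal.mul_ne_top (ENNReal.mul_ne_top ENNReal.ofReal_ne_top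
          (heatLint_enorm_sq_lt_top hS hB x).ne) ?_
        simp
      · refine setLIntegral_mono' measurableSet_Ioo fun τ hτ => ?_
        gcongr
        exact heatLint_heatOp_le hd hh hB (by linarith [hτ.1]) (by linarith [hτ.2]) x
    have h3 := (ENNReal.add_le_add_iff_right hfin).1 (h1.trans h2)
    exact (ENNReal.mul_le_mul_iff_right (ENNReal.ofReal_pos.2 hε).ne' ENNReal.ofReal_ne_top).1 h3
  have hU : Set.Ioo 0 T ⊆ ⋃ n : ℕ, Set.Ioo (1 / ((n : ℝ) + 1)) T := by
    intro τ hτ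
    obtain ⟨n, hn⟩ := exists_nat_one_div_lt hτ.1
    exact Set.mem_iUnion.2 ⟨n, hn, hτ.2⟩
  refine (lintegral_mono_set hU).trans ?_
  rw [setLIntegral_iUnion_of_directed]
  · exact iSup_le fun n => hstep _ Nat.one_div_pos_of_nat
  · refine Monotone.directed_le fun m n hmn => Set.Ioo_subset_Ioo_left ?_
    exact Nat.one_div_le_one_div hmn

end EnergyIntegral

section Maximal

variable {d : ℕ}

local notation "𝔼" => EuclideanSpace ℝ (Fin d)

lemma setLIntegral_ball_le_maxX (g : 𝔼 → ℝ) (x : 𝔼) {r : ℝ} (hr : 0 < r) :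
    ∫⁻ y in Metric.ball x r, ENNReal.ofReal |g y| ≤
      volume (Metric.ball x r) * maxX d g x := by
  rw [← ENNReal.inv_mul_le_iff (Metric.measure_ball_pos _ _ hr).ne' measure_ball_lt_top.ne]
  exact le_iSup₂ (f := fun (r : ℝ) (_ : 0 < r) =>
    (volume (Metric.ball x r))⁻¹ * ∫⁻ y in Metric.ball x r, ENNReal.ofReal |g y|) r hr

lemma summable_succ_pow_mul_exp (d : ℕ) :
    Summable fun k : ℕ => ((k : ℝ) + 1) ^ d * Real.exp (-(k : ℝ) ^ 2 / 4) := by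
  have h := (summable_nat_add_iff 1).2
    (Real.summable_pow_mul_exp_neg_nat_mul d (r := 1 / 2) (by norm_num))
  refine (h.mul_left (Real.exp 1)).of_nonneg_of_le (fun k => by positivity) fun k => ?_
  rw [mul_left_comm, ← Real.exp_add]
  push_cast
  gcongr
  nlinarith [sq_nonneg ((k : ℝ) - 1)]

lemma exists_heatLint_le_maxX (d : ℕ) :
    ∃ C : ℝ, 0 < C ∧ ∀ S : ℝ, 0 < S → ∀ (g : EuclideanSpace ℝ (Fin d) → ℝ)
      (x : EuclideanSpace ℝ (Fin d)),
      heatLint d S (fun y => ENNReal.ofReal |g y|) x ≤ ENNReal.ofReal C * maxX d g x := by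
  set ω := (volume (Metric.ball (0 : EuclideanSpace ℝ (Fin d)) 1)).toReal with hω
  have hωpos : 0 < ω :=
    ENNReal.toReal_pos (Metric.measure_ball_pos _ _ one_pos).ne' measure_ball_lt_top.ne
  set a : ℕ → ℝ := fun k => (4 * Real.pi) ^ (-(d : ℝ) / 2) * ω *
    (((k : ℝ) + 1) ^ d * Real.exp (-(k : ℝ) ^ 2 / 4)) with ha
  have hsum : Summable a := (summable_succ_pow_mul_exp d).mul_left _
  have hapos : ∀ k, 0 < a k := fun k => by positivity
  refine ⟨∑' k, a k, hsum.tsum_pos (fun k => (hapos k).le) 0 (hapos 0), fun S hS g x => ?_⟩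
  set r := √S with hr
  have hrpos : 0 < r := Real.sqrt_pos.2 hS
  set A : ℕ → Set (EuclideanSpace ℝ (Fin d)) := fun k =>
    {y | k * r ≤ ‖x - y‖ ∧ ‖x - y‖ < (k + 1) * r} with hA
  have hcover : (Set.univ : Set (EuclideanSpace ℝ (Fin d))) ⊆ ⋃ k, A k := by
    intro y _
    refine Set.mem_iUnion.2 ⟨⌊‖x - y‖ / r⌋₊, ?_, ?_⟩
    · exact (le_div_iff₀ hrpos).1 (Nat.floor_le (by positivity))
    · exact (div_lt_iff₀ hrpos).1 (Nat.lt_floor_add_one _)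
  have hn : Measurable fun y : EuclideanSpace ℝ (Fin d) => ‖x - y‖ := by fun_prop
  have hAm : ∀ k, MeasurableSet (A k) := fun k =>
    (measurableSet_le measurable_const hn).inter (measurableSet_lt hn measurable_const)
  have hshell : ∀ k, ∫⁻ y in A k, ENNReal.ofReal (heatKernel d S (x - y)) *
      ENNReal.ofReal |g y| ≤ ENNReal.ofReal (a k) * maxX d g x := by
    intro k
    set b := (4 * Real.pi * S) ^ (-(d : ℝ) / 2) * Real.exp (-(k : ℝ) ^ 2 / 4) with hb
    have h1 : ∫⁻ y in A k, ENNReal.ofReal (heatKernel d S (x - y)) * ENNReal.ofReal |g y| ≤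
        ∫⁻ y in A k, ENNReal.ofReal b * ENNReal.ofReal |g y| := by
      refine setLIntegral_mono' (hAm k) fun y hy => ?_
      gcongr
      rw [hb, heatKernel]
      gcongr 2
      rw [div_le_div_iff₀ (by positivity) (by norm_num)]
      have h2 : (k * r) ^ 2 ≤ ‖x - y‖ ^ 2 := pow_le_pow_left₀ (by positivity) hy.1 2
      rw [mul_pow, hr, Real.sq_sqrt hS.le] at h2
      linarith
    refine h1.trans ?_
    rw [lintegral_const_mul' _ _ ENNReal.ofReal_ne_top]
    have hsub : A k ⊆ Metric.ball x ((k + 1) * r) := by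
      intro y hy
      rw [Metric.mem_ball, dist_comm, dist_eq_norm]
      exact hy.2
    refine (mul_le_mul_right ((lintegral_mono_set hsub).trans
      (setLIntegral_ball_le_maxX g x (by positivity))) _).trans_eq ?_
    rw [← mul_assoc]
    congr 1
    rw [Measure.addHaar_ball_of_pos _ _ (by positivity), finrank_euclideanSpace, Fintype.card_fin,
      ← ENNReal.ofReal_toReal (a := volume (Metric.ball (0 : EuclideanSpace ℝ (Fin d)) 1))
        measure_ball_lt_top.ne, ← hω, ← ENNReal.ofReal_mul (by positivity),
      ← ENNReal.ofReal_mul (by positivity)]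
    congr 1
    have h3 : S ^ (-(d : ℝ) / 2) * r ^ d = 1 := by
      rw [hr, Real.sqrt_eq_rpow, ← Real.rpow_natCast, ← Real.rpow_mul hS.le, ← Real.rpow_add hS]
      ring_nf
      simp
    rw [hb, ha, Real.mul_rpow (by positivity) hS.le, mul_pow]
    linear_combination ((4 * Real.pi) ^ (-(d : ℝ) / 2) * ω *
      (((k : ℝ) + 1) ^ d * Real.exp (-(k : ℝ) ^ 2 / 4))) * h3
  calc heatLint d S (fun y => ENNReal.ofReal |g y|) x
      = ∫⁻ y in Set.univ, ENNReal.ofReal (heatKernel d S (x - y)) * ENNReal.ofReal |g y| := by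
        rw [Measure.restrict_univ, heatLint]
    _ ≤ ∑' k, ∫⁻ y in A k, ENNReal.ofReal (heatKernel d S (x - y)) * ENNReal.ofReal |g y| :=
        (lintegral_mono_set hcover).trans (lintegral_iUnion_le _ _)
    _ ≤ ∑' k, ENNReal.ofReal (a k) * maxX d g x := ENNReal.tsum_le_tsum hshell
    _ = _ := by
        rw [ENNReal.tsum_mul_right, ENNReal.ofReal_tsum_of_nonneg (fun k => (hapos k).le) hsum]

end Maximal

section Near

variable {d : ℕ}

local notation "𝔼" => EuclideanSpace ℝ (Fin d)

lemma heatKernel_ge {ℓ τ : ℝ} (hℓ : 0 < ℓ) (h1 : ℓ ^ 2 ≤ τ) (h2 : τ ≤ 3 * ℓ ^ 2) {z : 𝔼}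
    (hz : ‖z‖ ^ 2 ≤ d * ℓ ^ 2) :
    1 ≤ (12 * Real.pi) ^ ((d : ℝ) / 2) * Real.exp (d / 4) * ℓ ^ d * heatKernel d τ z := by
  have hτ : 0 < τ := lt_of_lt_of_le (by positivity) h1
  have hπ := Real.pi_pos
  have h3 : (12 * Real.pi * ℓ ^ 2) ^ (-(d : ℝ) / 2) ≤ (4 * Real.pi * τ) ^ (-(d : ℝ) / 2) := by
    refine Real.rpow_le_rpow_of_nonpos (by positivity) (by nlinarith) ?_
    have : (0 : ℝ) ≤ d := by positivity
    linarith
  have h4 : Real.exp (-(d / 4 : ℝ)) ≤ Real.exp (-‖z‖ ^ 2 / (4 * τ)) := by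
    rw [Real.exp_le_exp, neg_div, neg_le_neg_iff, div_le_div_iff₀ (by positivity) (by norm_num)]
    have : (d : ℝ) * ℓ ^ 2 ≤ d * τ := by gcongr
    nlinarith
  have h5 : (12 * Real.pi) ^ ((d : ℝ) / 2) * Real.exp (d / 4) * ℓ ^ d *
      ((12 * Real.pi * ℓ ^ 2) ^ (-(d : ℝ) / 2) * Real.exp (-(d / 4 : ℝ))) = 1 := by
    have h6 : (12 * Real.pi * ℓ ^ 2) ^ (-(d : ℝ) / 2) =
        ((12 * Real.pi) ^ ((d : ℝ) / 2))⁻¹ * (ℓ ^ d)⁻¹ := by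
      rw [Real.mul_rpow (by positivity) (by positivity), neg_div,
        Real.rpow_neg (by positivity) (_ / 2), Real.rpow_neg (by positivity) (_ / 2),
        ← Real.rpow_natCast ℓ 2, ← Real.rpow_mul hℓ.le, ← Real.rpow_natCast ℓ d]
      norm_num
      left
      rw [mul_div_cancel₀ (d : ℝ) two_ne_zero, Real.rpow_natCast]
    rw [h6, Real.exp_neg]
    field_simp
  rw [← h5, heatKernel]
  gcongr

lemma measurable_sub_fst {β γ : Type*} [MeasurableSpace β] [MeasurableSpace γ] {F : ℝ → β → γ}
    (hF : Measurable fun q : ℝ × β => F q.1 q.2) (s : ℝ) :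
    Measurable fun q : ℝ × β => F (q.1 - s) q.2 :=
  hF.comp ((measurable_fst.sub_const s).prodMk measurable_snd)

variable {V : Type*} [NormedAddCommGroup V] [InnerProductSpace ℝ V]

lemma enorm_sq_eq_ofReal_abs (v : V) : ‖v‖ₑ ^ 2 = ENNReal.ofReal |‖v‖ ^ 2| := by
  rw [abs_of_nonneg (by positivity), ENNReal.ofReal_pow (norm_nonneg _), ofReal_norm]

/-- The local gradient estimate for the heat flow in terms of the maximal function. -/
lemma exists_setLIntegral_heatGrad_le_maxX (d : ℕ) (hd : 1 ≤ d) :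
    ∃ C : ℝ, 0 < C ∧ ∀ (V : Type) [NormedAddCommGroup V] [InnerProductSpace ℝ V]
      [CompleteSpace V] (h : EuclideanSpace ℝ (Fin d) → V) (B : ℝ) (x : EuclideanSpace ℝ (Fin d))
      (D : Set (EuclideanSpace ℝ (Fin d))) (s ℓ : ℝ),
      StronglyMeasurable h → (∀ y, ‖h y‖ ≤ B) → 0 < ℓ → MeasurableSet D →
      (∀ w ∈ D, ‖x - w‖ ^ 2 ≤ d * ℓ ^ 2) →
      ∫⁻ p in Set.Ioo s (s + 2 * ℓ ^ 2) ×ˢ D, ‖heatGrad d (p.1 - s) h p.2‖ₑ ^ 2 ≤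
        ENNReal.ofReal (C * ℓ ^ d) * maxX d (fun y => ‖h y‖ ^ 2) x := by
  obtain ⟨C, hC, hmax⟩ := exists_heatLint_le_maxX d
  have hv : 0 < varConst d := by
    have : (0 : ℝ) < d := by exact_mod_cast hd
    unfold varConst
    positivity
  set K := (12 * Real.pi) ^ ((d : ℝ) / 2) * Real.exp (d / 4) with hK
  have hKpos : 0 < K := by positivity
  refine ⟨K * varConst d * C, by positivity, fun V _ _ _ h B x D s ℓ hh hB hℓ hD hDx => ?_⟩
  have hℓ2 : 0 < ℓ ^ 2 := by positivity
  set F : ℝ → EuclideanSpace ℝ (Fin d) → ℝ≥0∞ := fun τ w => ‖heatGrad d τ h w‖ₑ ^ 2 with hF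
  have hFm : Measurable fun q : ℝ × EuclideanSpace ℝ (Fin d) => F q.1 q.2 := by
    have h0 : Measurable fun q : ℝ × EuclideanSpace ℝ (Fin d) => ‖heatGrad d q.1 h q.2‖ₑ :=
      (stronglyMeasurable_heatGrad_uncurry hh).enorm
    exact h0.pow_const 2
  have hFs : Measurable fun q : ℝ × EuclideanSpace ℝ (Fin d) => F (q.1 - s) q.2 :=
    measurable_sub_fst hFm s
  have h1 : ∫⁻ p in Set.Ioo s (s + 2 * ℓ ^ 2) ×ˢ D, F (p.1 - s) p.2 =
      ∫⁻ t' in Set.Ioo s (s + 2 * ℓ ^ 2), ∫⁻ w in D, F (t' - s) w := by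
    rw [Measure.volume_eq_prod, ← Measure.prod_restrict]
    exact lintegral_prod _ hFs.aemeasurable
  have h2 : ∫⁻ t' in Set.Ioo s (s + 2 * ℓ ^ 2), ∫⁻ w in D, F (t' - s) w =
      ∫⁻ τ in Set.Ioo 0 (2 * ℓ ^ 2), ∫⁻ w in D, F τ w := by
    rw [← setLIntegral_Ioo_shift _ s]
    simp
  have h3 : ∀ τ ∈ Set.Ioo 0 (2 * ℓ ^ 2), ∫⁻ w in D, F τ w ≤
      ENNReal.ofReal (K * ℓ ^ d) * heatLint d (3 * ℓ ^ 2 - τ) (F τ) x := by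
    intro τ hτ
    rw [heatLint, ← lintegral_const_mul' _ _ ENNReal.ofReal_ne_top]
    refine le_trans (setLIntegral_mono' hD fun w hw => ?_) (setLIntegral_le_lintegral D _)
    rw [← mul_assoc, ← ENNReal.ofReal_mul (by positivity)]
    refine le_mul_of_one_le_left' ?_
    rw [← ENNReal.ofReal_one]
    exact ENNReal.ofReal_le_ofReal
      (heatKernel_ge hℓ (by linarith [hτ.2]) (by linarith [hτ.1]) (hDx w hw))
  calc _ = ∫⁻ τ in Set.Ioo 0 (2 * ℓ ^ 2), ∫⁻ w in D, F τ w := h1.trans h2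
    _ ≤ ∫⁻ τ in Set.Ioo 0 (2 * ℓ ^ 2), ENNReal.ofReal (K * ℓ ^ d) *
        heatLint d (3 * ℓ ^ 2 - τ) (F τ) x := setLIntegral_mono' measurableSet_Ioo h3
    _ ≤ ENNReal.ofReal (K * ℓ ^ d) * (ENNReal.ofReal (varConst d) *
        (ENNReal.ofReal C * maxX d (fun y => ‖h y‖ ^ 2) x)) := by
        rw [lintegral_const_mul' _ _ ENNReal.ofReal_ne_top]
        gcongr
        refine (lintegral_heatLint_heatGrad_le hd (by positivity) (by linarith) hh hB x).trans ?_
        gcongr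
        simp_rw [enorm_sq_eq_ofReal_abs]
        exact hmax _ (by positivity) _ _
    _ = _ := by
        rw [← mul_assoc, ← mul_assoc, ← ENNReal.ofReal_mul (by positivity),
          ← ENNReal.ofReal_mul (by positivity)]
        congr 2
        ring

end Near

section KernelDifference

variable {d : ℕ}

local notation "𝔼" => EuclideanSpace ℝ (Fin d)

lemma hasDerivAt_heatKernelDeriv_comp {τ : ℝ → ℝ} {z : ℝ → 𝔼} {a l : ℝ} {w : 𝔼} (j : Fin d)
    (hτ : HasDerivAt τ a l) (hz : HasDerivAt z w l) (hpos : 0 < τ l) :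
    HasDerivAt (fun l => heatKernelDeriv d j (τ l) (z l))
      (-(1 / 2) * heatKernel d (τ l) (z l) * (w j / τ l + z l j / τ l *
        (-(1 + (d : ℝ) / 2) * (a / τ l) - inner ℝ (z l) w / (2 * τ l) +
          ‖z l‖ ^ 2 / (4 * τ l) * (a / τ l)))) l := by
  have hπ := Real.pi_pos
  have h1 : HasDerivAt (fun l => z l j) (w j) l :=
    ((EuclideanSpace.proj (𝕜 := ℝ) j).hasFDerivAt.comp_hasDerivAt l hz)
  have h2 : HasDerivAt (fun l => ‖z l‖ ^ 2) (2 * inner ℝ (z l) w) l := hz.norm_sq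
  have h3 := ((h2.neg.div (hτ.const_mul 4) (by positivity)).exp)
  have h4 := (hτ.const_mul (4 * Real.pi)).rpow_const (p := -(d : ℝ) / 2)
    (Or.inl (by positivity))
  have h5 := ((h1.div (hτ.const_mul 2) (by positivity)).neg).mul (h4.mul h3)
  refine (h5.congr_deriv ?_)
  simp only [heatKernel, Pi.neg_apply, Pi.div_apply, Pi.mul_apply]
  rw [Real.rpow_sub_one (by positivity)]
  field_simp
  ring

lemma cubic_le_exp {D u : ℝ} (hD : 0 ≤ D) (hu : 0 ≤ u) :
    2 * √D + u * ((1 + D / 2) + √D * u + u ^ 2 / 4) ≤ 53 * (1 + D) * Real.exp (u ^ 2 / 8) := by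
  have h1 : √D ≤ 1 + D := by
    rw [Real.sqrt_le_left (by positivity)]
    nlinarith
  have h2 := Real.pow_div_factorial_le_exp (x := u ^ 2 / 8) (by positivity) 0
  have h3 := Real.pow_div_factorial_le_exp (x := u ^ 2 / 8) (by positivity) 1
  have h4 := Real.pow_div_factorial_le_exp (x := u ^ 2 / 8) (by positivity) 2
  norm_num [Nat.factorial] at h2 h3 h4
  set E := Real.exp (u ^ 2 / 8)
  have e1 : 1 ≤ E := Real.one_le_exp (by positivity)
  have e2 : u ^ 2 ≤ 8 * E := by linarith
  have e4 : u ^ 4 ≤ 128 * E := by nlinarith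
  have eu : u ≤ 9 * E := by nlinarith [sq_nonneg (u - 1)]
  have eu3 : u ^ 3 ≤ 136 * E := by nlinarith [mul_nonneg (sq_nonneg u) (sq_nonneg (u - 1))]
  have hs : 0 ≤ √D := Real.sqrt_nonneg _
  calc 2 * √D + u * ((1 + D / 2) + √D * u + u ^ 2 / 4)
      = √D * 2 + (1 + D / 2) * u + √D * u ^ 2 + u ^ 3 / 4 := by ring
    _ ≤ (1 + D) * (2 * E) + (1 + D) * (9 * E) + (1 + D) * (8 * E) + (1 + D) * (34 * E) := by
        have a1 : √D * 2 ≤ (1 + D) * (2 * E) := by nlinarith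
        have a2 : (1 + D / 2) * u ≤ (1 + D) * (9 * E) := by
          apply mul_le_mul (by linarith) eu hu (by positivity)
        have a3 : √D * u ^ 2 ≤ (1 + D) * (8 * E) := by
          apply mul_le_mul h1 e2 (by positivity) (by positivity)
        have a4 : u ^ 3 / 4 ≤ (1 + D) * (34 * E) := by nlinarith
        linarith
    _ = _ := by ring

lemma abs_deriv_heatKernelDeriv_le {τ ℓ a : ℝ} {z w : 𝔼} (j : Fin d) (hℓ : 0 < ℓ)
    (hτ : ℓ ^ 2 ≤ τ) (ha : |a| ≤ ℓ ^ 2) (hw : ‖w‖ ≤ 2 * √d * ℓ) :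
    |-(1 / 2) * heatKernel d τ z * (w j / τ + z j / τ *
        (-(1 + (d : ℝ) / 2) * (a / τ) - inner ℝ z w / (2 * τ) + ‖z‖ ^ 2 / (4 * τ) * (a / τ)))| ≤
      53 * (1 + d) * (ℓ / τ) * ((2 : ℝ) ^ ((d : ℝ) / 2) * heatKernel d (2 * τ) z) := by
  have hτpos : 0 < τ := lt_of_lt_of_le (by positivity) hτ
  set m := √τ with hm
  have hmpos : 0 < m := Real.sqrt_pos.2 hτpos
  have hm2 : τ = m ^ 2 := (Real.sq_sqrt hτpos.le).symm
  have hℓm : ℓ ≤ m := Real.le_sqrt_of_sq_le hτ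
  set u := ‖z‖ / m with hu
  have hz : ‖z‖ = u * m := by rw [hu]; field_simp
  have hu0 : 0 ≤ u := by positivity
  have hα : |a / τ| ≤ ℓ / m := by
    rw [abs_div, abs_of_pos hτpos, div_le_div_iff₀ hτpos hmpos, hm2]
    calc |a| * m ≤ ℓ ^ 2 * m := by gcongr
      _ = ℓ * (ℓ * m) := by ring
      _ ≤ ℓ * (m * m) := by gcongr
      _ = _ := by ring
  have hwj : |w j / τ| ≤ ℓ / τ * (2 * √d) := by
    rw [abs_div, abs_of_pos hτpos, div_mul_eq_mul_div]
    gcongr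
    have := PiLp.norm_apply_le w j
    rw [Real.norm_eq_abs] at this
    linarith
  have hzj : |z j / τ| ≤ u / m := by
    rw [abs_div, abs_of_pos hτpos, hu, div_div, hm2, ← sq]
    gcongr
    exact PiLp.norm_apply_le z j
  have hin : |inner ℝ z w / (2 * τ)| ≤ ℓ / m * (√d * u) := by
    rw [abs_div, abs_of_pos (by positivity : 0 < 2 * τ), div_le_iff₀ (by positivity), hm2]
    calc |inner ℝ z w| ≤ ‖z‖ * ‖w‖ := abs_real_inner_le_norm _ _
      _ ≤ u * m * (2 * √d * ℓ) := by rw [hz]; gcongr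
      _ = _ := by field_simp
  have hsq : |‖z‖ ^ 2 / (4 * τ) * (a / τ)| ≤ ℓ / m * (u ^ 2 / 4) := by
    rw [abs_mul, abs_of_nonneg (by positivity : 0 ≤ ‖z‖ ^ 2 / (4 * τ)), mul_comm]
    have : ‖z‖ ^ 2 / (4 * τ) = u ^ 2 / 4 := by
      rw [hz, hm2]
      field_simp
    rw [this]
    gcongr
  have hfst : |-(1 + (d : ℝ) / 2) * (a / τ)| ≤ ℓ / m * (1 + d / 2) := by
    rw [abs_mul, abs_neg, abs_of_nonneg (by positivity : 0 ≤ 1 + (d : ℝ) / 2), mul_comm]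
    gcongr
  have hX : |-(1 + (d : ℝ) / 2) * (a / τ) - inner ℝ z w / (2 * τ) +
      ‖z‖ ^ 2 / (4 * τ) * (a / τ)| ≤ ℓ / m * ((1 + d / 2) + √d * u + u ^ 2 / 4) := by
    refine (abs_add_le _ _).trans ?_
    refine (add_le_add ((abs_sub _ _).trans (add_le_add hfst hin)) hsq).trans_eq ?_
    ring
  have hbr : |w j / τ + z j / τ * (-(1 + (d : ℝ) / 2) * (a / τ) - inner ℝ z w / (2 * τ) +
      ‖z‖ ^ 2 / (4 * τ) * (a / τ))| ≤ ℓ / τ * (53 * (1 + d) * Real.exp (u ^ 2 / 8)) := by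
    refine (abs_add_le _ _).trans ?_
    rw [abs_mul]
    calc _ ≤ ℓ / τ * (2 * √d) + u / m * (ℓ / m * ((1 + d / 2) + √d * u + u ^ 2 / 4)) := by
          gcongr
      _ = ℓ / τ * (2 * √d + u * ((1 + d / 2) + √d * u + u ^ 2 / 4)) := by
          rw [hm2]
          field_simp
      _ ≤ _ := by
          gcongr
          exact cubic_le_exp (by positivity) hu0
  have hG : heatKernel d τ z * Real.exp (u ^ 2 / 8) =
      (2 : ℝ) ^ ((d : ℝ) / 2) * heatKernel d (2 * τ) z := by
    rw [rpow_two_mul_heatKernel hτpos, heatKernel, mul_assoc, ← Real.exp_add]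
    congr 2
    rw [hz, hm2]
    field_simp
    ring
  have hGpos := (heatKernel_pos hτpos z).le
  rw [abs_mul, abs_mul, abs_of_nonneg hGpos, ← hG]
  have e1 : |(-(1 / 2) : ℝ)| ≤ 1 := by norm_num [abs_of_nonneg]
  calc _ ≤ 1 * heatKernel d τ z * (ℓ / τ * (53 * (1 + d) * Real.exp (u ^ 2 / 8))) := by gcongr
    _ = _ := by ring

lemma heatKernel_le_of_le {r τ : ℝ} (hr : 0 < r) (h1 : r ≤ τ) (h2 : τ ≤ 2 * r) (z : 𝔼) :
    heatKernel d τ z ≤ (2 : ℝ) ^ ((d : ℝ) / 2) * heatKernel d (2 * r) z := by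
  have hτ : 0 < τ := hr.trans_le h1
  rw [rpow_two_mul_heatKernel hr, heatKernel]
  have hπ := Real.pi_pos
  have hd : -(d : ℝ) / 2 ≤ 0 := by
    have : (0 : ℝ) ≤ d := by positivity
    linarith
  have e1 : (4 * Real.pi * τ) ^ (-(d : ℝ) / 2) ≤ (4 * Real.pi * r) ^ (-(d : ℝ) / 2) :=
    Real.rpow_le_rpow_of_nonpos (by positivity) (by gcongr) hd
  have e2 : Real.exp (-‖z‖ ^ 2 / (4 * τ)) ≤ Real.exp (-‖z‖ ^ 2 / (8 * r)) := by
    rw [Real.exp_le_exp, neg_div, neg_div, neg_le_neg_iff]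
    exact div_le_div_of_nonneg_left (by positivity) (by positivity) (by linarith)
  gcongr

lemma abs_heatKernelDeriv_sub_le {r ℓ τ₁ τ₂ : ℝ} {z z₁ z₂ : 𝔼} (j : Fin d) (hℓ : 0 < ℓ)
    (hr : ℓ ^ 2 ≤ r) (h₁ : τ₁ ∈ Set.Icc r (2 * r)) (h₂ : τ₂ ∈ Set.Icc r (2 * r))
    (hτ : |τ₁ - τ₂| ≤ ℓ ^ 2) (hz₁ : ‖z₁ - z‖ ≤ √d * ℓ) (hz₂ : ‖z₂ - z‖ ≤ √d * ℓ) :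
    |heatKernelDeriv d j τ₁ z₁ - heatKernelDeriv d j τ₂ z₂| ≤
      53 * (1 + d) * ((2 : ℝ) ^ ((d : ℝ) / 2)) ^ 3 * Real.exp (d / 4) * (ℓ / r) *
        heatKernel d (8 * r) z := by
  have hrpos : 0 < r := lt_of_lt_of_le (by positivity) hr
  set P := (2 : ℝ) ^ ((d : ℝ) / 2) with hP
  have hPpos : 0 < P := by positivity
  set τ : ℝ → ℝ := fun l => τ₂ + l * (τ₁ - τ₂) with hτdef
  set ζ : ℝ → 𝔼 := fun l => z₂ + l • (z₁ - z₂) with hζ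
  have hτmem : ∀ l ∈ Set.Icc (0 : ℝ) 1, τ l ∈ Set.Icc r (2 * r) := by
    intro l hl
    have := (convex_Icc r (2 * r)).add_smul_sub_mem h₂ h₁ hl
    simpa [hτdef] using this
  have hζmem : ∀ l ∈ Set.Icc (0 : ℝ) 1, ‖ζ l - z‖ ≤ √d * ℓ := by
    intro l hl
    have := (convex_closedBall z (√d * ℓ)).add_smul_sub_mem
      (mem_closedBall_iff_norm.2 hz₂) (mem_closedBall_iff_norm.2 hz₁) hl
    exact mem_closedBall_iff_norm.1 this
  have hτ' : ∀ l, HasDerivAt τ (τ₁ - τ₂) l := fun l => by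
    have h := ((hasDerivAt_id l).mul_const (τ₁ - τ₂)).const_add τ₂
    rw [one_mul] at h
    exact h
  have hζ' : ∀ l, HasDerivAt ζ (z₁ - z₂) l := fun l => by
    have h := ((hasDerivAt_id l).smul_const (z₁ - z₂)).const_add z₂
    rw [one_smul] at h
    exact h
  have hw : ‖z₁ - z₂‖ ≤ 2 * √d * ℓ := by
    calc ‖z₁ - z₂‖ = ‖(z₁ - z) - (z₂ - z)‖ := by congr 1; abel
      _ ≤ ‖z₁ - z‖ + ‖z₂ - z‖ := norm_sub_le _ _
      _ ≤ _ := by linarith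
  have hbound : ∀ l ∈ Set.Icc (0 : ℝ) 1,
      53 * (1 + d) * (ℓ / τ l) * (P * heatKernel d (2 * τ l) (ζ l)) ≤
      53 * (1 + d) * P ^ 3 * Real.exp (d / 4) * (ℓ / r) * heatKernel d (8 * r) z := by
    intro l hl
    have hl' := hτmem l hl
    have hpos : 0 < τ l := hrpos.trans_le hl'.1
    have e1 : heatKernel d (2 * τ l) (ζ l) ≤
        Real.exp (d / 4) * (P * heatKernel d (2 * (2 * τ l)) z) := by
      refine heatKernel_le_of_near (by positivity) ?_
      calc ‖ζ l - z‖ ^ 2 ≤ (√d * ℓ) ^ 2 := pow_le_pow_left₀ (norm_nonneg _) (hζmem l hl) 2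
        _ = d * ℓ ^ 2 := by rw [mul_pow, Real.sq_sqrt (by positivity)]
        _ ≤ d * (2 * τ l) := by
          gcongr
          linarith [hl'.1]
    have e2 : heatKernel d (2 * (2 * τ l)) z ≤ P * heatKernel d (8 * r) z := by
      have := heatKernel_le_of_le (d := d) (r := 4 * r) (τ := 2 * (2 * τ l)) (by positivity)
        (by linarith [hl'.1]) (by linarith [hl'.2]) z
      rwa [show 2 * (4 * r) = 8 * r by ring] at this
    have e3 : ℓ / τ l ≤ ℓ / r := by
      gcongr
      exact hl'.1
    calc _ ≤ 53 * (1 + d) * (ℓ / r) * (P * (Real.exp (d / 4) * (P *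
          (P * heatKernel d (8 * r) z)))) := by
          have := (heatKernel_pos (d := d) (t := 2 * τ l) (by positivity) (ζ l)).le
          gcongr
          exact e1.trans (by gcongr)
      _ = _ := by ring
  have h := norm_image_sub_le_of_norm_deriv_le_segment_01'
    (f := fun l => heatKernelDeriv d j (τ l) (ζ l))
    (fun l hl => (hasDerivAt_heatKernelDeriv_comp j (hτ' l) (hζ' l)
      (hrpos.trans_le (hτmem l hl).1)).hasDerivWithinAt)
    (fun l hl => (abs_deriv_heatKernelDeriv_le j hℓ (hr.trans (hτmem l ⟨hl.1, hl.2.le⟩).1) hτ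
      hw).trans (hbound l ⟨hl.1, hl.2.le⟩))
  simpa [hτdef, hζ, Real.norm_eq_abs] using h

end KernelDifference

section Far

variable {d : ℕ}

local notation "𝔼" => EuclideanSpace ℝ (Fin d)

lemma heatLint_sq_le {t : ℝ} (ht : 0 < t) {g : 𝔼 → ℝ≥0∞} (hg : Measurable g) (x : 𝔼) :
    heatLint d t g x ^ 2 ≤ heatLint d t (fun y => g y ^ 2) x := by
  have hk : Measurable (heatKernel d t) := (continuous_heatKernel t).measurable
  have hkx : Measurable fun y => ENNReal.ofReal (heatKernel d t (x - y)) := by fun_prop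
  set μ : Measure 𝔼 := volume.withDensity fun y => ENNReal.ofReal (heatKernel d t (x - y)) with hμ
  have hone : μ Set.univ = 1 := by
    rw [hμ, withDensity_apply _ MeasurableSet.univ, Measure.restrict_univ,
      lintegral_heatKernel_sub ht]
  have hlint : ∀ g : 𝔼 → ℝ≥0∞, Measurable g → heatLint d t g x = ∫⁻ y, g y ∂μ := fun g hg => by
    rw [hμ, lintegral_withDensity_eq_lintegral_mul _ hkx hg]
    rfl
  rw [hlint g hg, hlint _ (hg.pow_const 2)]
  have h := ENNReal.lintegral_mul_le_Lp_mul_Lq μ (p := 2) (q := 2)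
    (by rw [Real.holderConjugate_iff]; norm_num) hg.aemeasurable
    (aemeasurable_const (b := (1 : ℝ≥0∞)))
  simp only [Pi.mul_apply, mul_one, ENNReal.one_rpow, lintegral_const, hone] at h
  calc _ ≤ ((∫⁻ y, g y ^ (2 : ℝ) ∂μ) ^ (1 / 2 : ℝ)) ^ 2 := pow_le_pow_left₀ zero_le h 2
    _ = _ := by
      rw [← ENNReal.rpow_natCast, ← ENNReal.rpow_mul]
      norm_num

variable {V : Type*} [NormedAddCommGroup V] [InnerProductSpace ℝ V]

lemma enorm_pi_sq (v : PiLp 2 (fun _ : Fin d => V)) : ‖v‖ₑ ^ 2 = ∑ j, ‖v j‖ₑ ^ 2 := by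
  simp_rw [← ofReal_norm, ← ENNReal.ofReal_pow (norm_nonneg _)]
  rw [PiLp.norm_sq_eq_of_L2, ENNReal.ofReal_sum_of_nonneg fun j _ => by positivity]

end Far

lemma exists_enorm_heatGrad_sub_sq_le_maxX (d : ℕ) :
    ∃ C : ℝ, 0 < C ∧ ∀ (V : Type) [NormedAddCommGroup V] [InnerProductSpace ℝ V]
      (h : EuclideanSpace ℝ (Fin d) → V) (B : ℝ) (x x₁ x₂ : EuclideanSpace ℝ (Fin d))
      (ℓ r τ₁ τ₂ : ℝ),
      StronglyMeasurable h → (∀ y, ‖h y‖ ≤ B) → 0 < ℓ → ℓ ^ 2 ≤ r →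
      τ₁ ∈ Set.Icc r (2 * r) → τ₂ ∈ Set.Icc r (2 * r) → |τ₁ - τ₂| ≤ ℓ ^ 2 →
      ‖x₁ - x‖ ≤ √d * ℓ → ‖x₂ - x‖ ≤ √d * ℓ →
      ‖heatGrad d τ₁ h x₁ - heatGrad d τ₂ h x₂‖ₑ ^ 2 ≤
        ENNReal.ofReal (C * (ℓ / r) ^ 2) * maxX d (fun y => ‖h y‖ ^ 2) x := by
  obtain ⟨C, hC, hmax⟩ := exists_heatLint_le_maxX d
  set K := 53 * (1 + (d : ℝ)) * ((2 : ℝ) ^ ((d : ℝ) / 2)) ^ 3 * Real.exp (d / 4) with hK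
  have hKpos : 0 < K := by positivity
  refine ⟨(d + 1) * K ^ 2 * C, by positivity, ?_⟩
  intro V _ _ h B x x₁ x₂ ℓ r τ₁ τ₂ hh hB hℓ hr h₁ h₂ hτ hx₁ hx₂
  have hrpos : 0 < r := lt_of_lt_of_le (by positivity) hr
  set M := maxX d (fun y => ‖h y‖ ^ 2) x with hM
  have hcoord : ∀ j, ‖(heatGrad d τ₁ h x₁ - heatGrad d τ₂ h x₂) j‖ₑ ^ 2 ≤
      ENNReal.ofReal ((K * (ℓ / r)) ^ 2 * C) * M := by
    intro j
    have hi₁ := integrable_heatKernelDeriv_smul (hrpos.trans_le h₁.1) hh hB j x₁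
    have hi₂ := integrable_heatKernelDeriv_smul (hrpos.trans_le h₂.1) hh hB j x₂
    have e1 : ‖(heatGrad d τ₁ h x₁ - heatGrad d τ₂ h x₂) j‖ₑ ≤
        ENNReal.ofReal (K * (ℓ / r)) * heatLint d (8 * r) (fun y => ‖h y‖ₑ) x := by
      rw [PiLp.sub_apply, heatGrad_apply, heatGrad_apply, ← integral_sub hi₁ hi₂]
      refine (enorm_integral_le_lintegral_enorm _).trans ?_
      rw [heatLint, ← lintegral_const_mul' _ _ ENNReal.ofReal_ne_top]
      refine lintegral_mono fun y => ?_
      rw [← sub_smul, enorm_smul, ← mul_assoc, ← ENNReal.ofReal_mul (by positivity)]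
      gcongr
      rw [Real.enorm_eq_ofReal_abs]
      exact ENNReal.ofReal_le_ofReal (abs_heatKernelDeriv_sub_le j hℓ hr h₁ h₂ hτ
        (by simpa using hx₁) (by simpa using hx₂))
    calc _ ≤ (ENNReal.ofReal (K * (ℓ / r)) * heatLint d (8 * r) (fun y => ‖h y‖ₑ) x) ^ 2 :=
          pow_le_pow_left₀ zero_le e1 2
      _ ≤ ENNReal.ofReal ((K * (ℓ / r)) ^ 2) * (ENNReal.ofReal C * M) := by
          rw [mul_pow, ENNReal.ofReal_pow (by positivity)]
          gcongr
          refine (heatLint_sq_le (by positivity) hh.enorm x).trans ?_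
          simp_rw [enorm_sq_eq_ofReal_abs]
          exact hmax _ (by positivity) _ _
      _ = _ := by rw [← mul_assoc, ← ENNReal.ofReal_mul (by positivity)]
  rw [enorm_pi_sq]
  calc _ ≤ ∑ j : Fin d, ENNReal.ofReal ((K * (ℓ / r)) ^ 2 * C) * M :=
        Finset.sum_le_sum fun j _ => hcoord j
    _ = ENNReal.ofReal (d * ((K * (ℓ / r)) ^ 2 * C)) * M := by
        rw [Finset.sum_const, Finset.card_univ, Fintype.card_fin, nsmul_eq_mul, ← mul_assoc,
          ENNReal.ofReal_mul (by positivity) (p := (d : ℝ)), ENNReal.ofReal_natCast]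
    _ ≤ _ := by
        refine mul_le_mul' (ENNReal.ofReal_le_ofReal ?_) le_rfl
        have : (0 : ℝ) ≤ (K * (ℓ / r)) ^ 2 * C := by positivity
        nlinarith

lemma exists_enorm_heatGrad_sq_le_maxX (d : ℕ) :
    ∃ C : ℝ, 0 < C ∧ ∀ (V : Type) [NormedAddCommGroup V] [InnerProductSpace ℝ V] [CompleteSpace V]
      (h : EuclideanSpace ℝ (Fin d) → V) (B : ℝ) (x : EuclideanSpace ℝ (Fin d)) (τ : ℝ),
      StronglyMeasurable h → (∀ y, ‖h y‖ ≤ B) → 0 < τ →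
      ‖heatGrad d τ h x‖ₑ ^ 2 ≤
        ENNReal.ofReal (C / τ) * maxX d (fun y => ‖h y‖ ^ 2) x := by
  obtain ⟨C, hC, hmax⟩ := exists_heatLint_le_maxX d
  have hv : 0 ≤ varConst d := by
    unfold varConst
    positivity
  refine ⟨(varConst d + 1) * C, by positivity, fun V _ _ _ h B x τ hh hB hτ => ?_⟩
  have e1 := le_trans le_self_add (enorm_heatGrad_sq_add_le hτ hh hB x)
  have e2 : ENNReal.ofReal τ * ‖heatGrad d τ h x‖ₑ ^ 2 ≤
      ENNReal.ofReal τ * (ENNReal.ofReal ((varConst d + 1) * C / τ) *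
        maxX d (fun y => ‖h y‖ ^ 2) x) := by
    calc _ ≤ ENNReal.ofReal (varConst d + 1) * (ENNReal.ofReal C *
          maxX d (fun y => ‖h y‖ ^ 2) x) := by
          refine e1.trans (mul_le_mul' (ENNReal.ofReal_le_ofReal (by linarith)) ?_)
          simp_rw [enorm_sq_eq_ofReal_abs]
          exact hmax _ hτ _ _
      _ = _ := by
          rw [← mul_assoc, ← mul_assoc, ← ENNReal.ofReal_mul (by positivity),
            ← ENNReal.ofReal_mul hτ.le, mul_div_cancel₀ _ hτ.ne']
  exact (ENNReal.mul_le_mul_iff_right (ENNReal.ofReal_pos.2 hτ).ne' ENNReal.ofReal_ne_top).1 e2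

section Minkowski

variable {Ω Θ : Type*} [MeasurableSpace Ω] [MeasurableSpace Θ]

/-- Minkowski's integral inequality. -/
lemma lintegral_rpow_lintegral_le {μ : Measure Ω} [IsFiniteMeasure μ] {ν : Measure Θ} [SFinite ν]
    {q : ℝ} (hq : 1 < q) {F : Ω → Θ → ℝ≥0∞} (hF : Measurable (Function.uncurry F)) :
    ∫⁻ ω, (∫⁻ θ, F ω θ ∂ν) ^ q ∂μ ≤ (∫⁻ θ, (∫⁻ ω, F ω θ ^ q ∂μ) ^ (1 / q) ∂ν) ^ q := by
  have hq0 : 0 < q := one_pos.trans hq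
  have hconj : q.HolderConjugate (q.conjExponent) := Real.HolderConjugate.conjExponent hq
  set R := ∫⁻ θ, (∫⁻ ω, F ω θ ^ q ∂μ) ^ (1 / q) ∂ν with hR
  set A : Ω → ℝ≥0∞ := fun ω => ∫⁻ θ, F ω θ ∂ν with hA
  have hAm : Measurable A := hF.lintegral_prod_right'
  have hmin : ∀ n : ℕ, Measurable fun ω => min (A ω) n := fun n => hAm.min measurable_const
  have hK : ∀ n : ℕ, ∫⁻ ω, min (A ω) n ^ q ∂μ ≤ R ^ q := fun n => by
    set K := ∫⁻ ω, min (A ω) n ^ q ∂μ with hKdef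
    have hKtop : K ≠ ∞ := by
      refine ne_top_of_le_ne_top (b := (n : ℝ≥0∞) ^ q * μ Set.univ)
        (ENNReal.mul_ne_top (ENNReal.rpow_ne_top_of_nonneg hq0.le (natCast_ne_top n))
          (measure_ne_top _ _)) ?_
      rw [← lintegral_const]
      exact lintegral_mono fun ω => ENNReal.rpow_le_rpow (min_le_right _ _) hq0.le
    rcases eq_or_ne K 0 with h0 | h0
    · rw [h0]; exact zero_le
    have hexp : ∀ ω, (min (A ω) n ^ (q - 1)) ^ q.conjExponent = min (A ω) n ^ q := fun ω => by
      rw [← ENNReal.rpow_mul, Real.HolderConjugate.sub_one_mul_conj hconj]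
    have key : K ≤ R * K ^ (1 / q.conjExponent) := by
      calc K ≤ ∫⁻ ω, min (A ω) n ^ (q - 1) * A ω ∂μ := by
            refine lintegral_mono fun ω => ?_
            have : min (A ω) n ^ q = min (A ω) n ^ (q - 1) * min (A ω) n := by
              conv_rhs => rw [← ENNReal.rpow_one (min (A ω) n), ← ENNReal.rpow_mul, one_mul]
              rw [← ENNReal.rpow_add_of_nonneg _ _ (by linarith) zero_le_one]
              simp
            simp only [this]
            exact mul_le_mul_right (min_le_left _ _) _
        _ = ∫⁻ ω, ∫⁻ θ, min (A ω) n ^ (q - 1) * F ω θ ∂ν ∂μ := by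
            refine lintegral_congr fun ω => ?_
            exact (lintegral_const_mul _ (hF.comp measurable_prodMk_left)).symm
        _ = ∫⁻ θ, ∫⁻ ω, min (A ω) n ^ (q - 1) * F ω θ ∂μ ∂ν := by
            refine lintegral_lintegral_swap (Measurable.aemeasurable ?_)
            exact (((hmin n).comp measurable_fst).pow_const _).mul hF
        _ ≤ ∫⁻ θ, (∫⁻ ω, F ω θ ^ q ∂μ) ^ (1 / q) * K ^ (1 / q.conjExponent) ∂ν := by
            refine lintegral_mono fun θ => ?_
            have := ENNReal.lintegral_mul_le_Lp_mul_Lq μ hconj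
              (f := fun ω => F ω θ) (g := fun ω => min (A ω) n ^ (q - 1))
              (hF.comp measurable_prodMk_right).aemeasurable ((hmin n).pow_const _).aemeasurable
            simp only [hexp, Pi.mul_apply] at this
            simpa only [mul_comm] using this
        _ = R * K ^ (1 / q.conjExponent) := by
            refine lintegral_mul_const' _ _ (ENNReal.rpow_ne_top_of_nonneg ?_ hKtop)
            exact (one_div_pos.2 hconj.symm.pos).le
    have hsplit : K = K ^ (1 / q) * K ^ (1 / q.conjExponent) := by
      rw [← ENNReal.rpow_add _ _ h0 hKtop, one_div, one_div, hconj.inv_add_inv_eq_one,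
        ENNReal.rpow_one]
    have hne : K ^ (1 / q.conjExponent) ≠ 0 := (ENNReal.rpow_pos (pos_iff_ne_zero.2 h0) hKtop).ne'
    have hnt : K ^ (1 / q.conjExponent) ≠ ∞ :=
      ENNReal.rpow_ne_top_of_nonneg (one_div_pos.2 hconj.symm.pos).le hKtop
    have h1 : K ^ (1 / q) ≤ R := by
      rw [hsplit] at key
      rw [← ENNReal.mul_le_mul_iff_left hne hnt]
      rw [← hsplit] at key ⊢
      exact key
    calc K = (K ^ (1 / q)) ^ q := by rw [← ENNReal.rpow_mul, one_div_mul_cancel hq0.ne',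
          ENNReal.rpow_one]
      _ ≤ R ^ q := ENNReal.rpow_le_rpow h1 hq0.le
  have hsup : ∀ ω, A ω ^ q = ⨆ n : ℕ, min (A ω) n ^ q := fun ω => by
    have h1 : A ω = ⨆ n : ℕ, min (A ω) n := by
      rw [← inf_iSup_eq, ENNReal.iSup_natCast, inf_top_eq]
    conv_lhs => rw [h1]
    exact (ENNReal.orderIsoRpow q hq0).map_iSup _
  change ∫⁻ ω, A ω ^ q ∂μ ≤ _
  rw [lintegral_congr hsup, lintegral_iSup (fun n => (hmin n).pow_const _)]
  · exact iSup_le hK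
  · intro m n hmn ω
    exact ENNReal.rpow_le_rpow (min_le_min le_rfl (by exact_mod_cast hmn)) hq0.le

end Minkowski

section Time

lemma setLIntegral_Ioo_le_maxT (F : ℝ → ℝ≥0∞) (t : ℝ) {r : ℝ} (hr : 0 < r) :
    ∫⁻ s in Set.Ioo (t - r) (t + r), F s ≤ ENNReal.ofReal (2 * r) * maxT F t := by
  have h0 : ENNReal.ofReal (2 * r) ≠ 0 := by simpa using hr
  have h1 : (ENNReal.ofReal (2 * r))⁻¹ * ∫⁻ s in Set.Ioo (t - r) (t + r), F s ≤ maxT F t :=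
    le_iSup₂ (f := fun (r : ℝ) (_ : 0 < r) =>
      (ENNReal.ofReal (2 * r))⁻¹ * ∫⁻ s in Set.Ioo (t - r) (t + r), F s) r hr
  calc _ = ENNReal.ofReal (2 * r) *
        ((ENNReal.ofReal (2 * r))⁻¹ * ∫⁻ s in Set.Ioo (t - r) (t + r), F s) := by
        rw [← mul_assoc, ENNReal.mul_inv_cancel h0 ofReal_ne_top, one_mul]
    _ ≤ _ := mul_le_mul_right h1 _

lemma lintegral_shells_le_maxT (F : ℝ → ℝ≥0∞) {a t ℓ : ℝ} (hℓ : 0 < ℓ) (hat : a ≤ t)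
    (hta : t < a + ℓ ^ 2) :
    ∫⁻ s in Set.Iio (a - ℓ ^ 2), ENNReal.ofReal ((ℓ / (a - s)) ^ 2) * F s ≤ 16 * maxT F t := by
  set A : ℕ → Set ℝ := fun k => Set.Ioc (a - 2 ^ (k + 1) * ℓ ^ 2) (a - 2 ^ k * ℓ ^ 2) with hA
  have hℓ2 : 0 < ℓ ^ 2 := by positivity
  have hcover : Set.Iio (a - ℓ ^ 2) ⊆ ⋃ k, A k := fun s hs => by
    rw [Set.mem_Iio] at hs
    obtain ⟨k, hk1, hk2⟩ := exists_nat_pow_near (x := (a - s) / ℓ ^ 2) (y := (2 : ℝ))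
      (by rw [le_div_iff₀ hℓ2]; linarith) one_lt_two
    rw [le_div_iff₀ hℓ2] at hk1
    rw [div_lt_iff₀ hℓ2] at hk2
    exact Set.mem_iUnion.2 ⟨k, by constructor <;> linarith⟩
  have hshell : ∀ k, ∫⁻ s in A k, ENNReal.ofReal ((ℓ / (a - s)) ^ 2) * F s ≤
      ENNReal.ofReal (8 * (1 / 2) ^ k) * maxT F t := fun k => by
    have h2k : (1 : ℝ) ≤ 2 ^ k := one_le_pow₀ one_le_two
    have hr : 0 < 2 ^ (k + 2) * ℓ ^ 2 := by positivity
    have hsub : A k ⊆ Set.Ioo (t - 2 ^ (k + 2) * ℓ ^ 2) (t + 2 ^ (k + 2) * ℓ ^ 2) := fun s hs => by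
      have h1 := hs.1
      have h2 := hs.2
      have h3 : (2 : ℝ) ^ (k + 1) * ℓ ^ 2 = 2 * (2 ^ k * ℓ ^ 2) := by ring
      have h4 : (2 : ℝ) ^ (k + 2) * ℓ ^ 2 = 4 * (2 ^ k * ℓ ^ 2) := by ring
      have h5 : ℓ ^ 2 ≤ 2 ^ k * ℓ ^ 2 := by nlinarith
      constructor <;> linarith
    calc _ ≤ ∫⁻ s in A k, ENNReal.ofReal ((1 / 4) ^ k * (ℓ ^ 2)⁻¹) * F s := by
          refine setLIntegral_mono' measurableSet_Ioc fun s hs => mul_le_mul_left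
            (ENNReal.ofReal_le_ofReal ?_) _
          have h1 : 2 ^ k * ℓ ^ 2 ≤ a - s := by linarith [hs.2]
          have h0 : 0 < 2 ^ k * ℓ ^ 2 := by positivity
          have e : ((1 : ℝ) / 4) ^ k * (ℓ ^ 2)⁻¹ = (ℓ / (2 ^ k * ℓ ^ 2)) ^ 2 := by
            rw [div_pow, div_pow, mul_pow, one_pow, ← pow_mul, mul_comm k 2, pow_mul]
            norm_num
            field_simp
          have h3 : 0 < a - s := h0.trans_le h1
          rw [e]
          gcongr
      _ = ENNReal.ofReal ((1 / 4) ^ k * (ℓ ^ 2)⁻¹) * ∫⁻ s in A k, F s :=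
          lintegral_const_mul' _ _ ofReal_ne_top
      _ ≤ ENNReal.ofReal ((1 / 4) ^ k * (ℓ ^ 2)⁻¹) *
            (ENNReal.ofReal (2 * (2 ^ (k + 2) * ℓ ^ 2)) * maxT F t) :=
          mul_le_mul_right ((lintegral_mono_set hsub).trans (setLIntegral_Ioo_le_maxT F t hr)) _
      _ = _ := by
          rw [← mul_assoc, ← ENNReal.ofReal_mul (by positivity)]
          congr 2
          have : ((1 : ℝ) / 2) ^ k = (1 / 4) ^ k * 2 ^ k := by
            rw [← mul_pow]; norm_num
          rw [this]
          field_simp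
          ring
  have hgeom : ∑' k : ℕ, ENNReal.ofReal (8 * (1 / 2) ^ k) = 16 := by
    rw [← ENNReal.ofReal_tsum_of_nonneg (fun k => by positivity)
      (summable_geometric_two.mul_left 8), tsum_mul_left, tsum_geometric_two]
    norm_num
  calc _ ≤ ∫⁻ s in ⋃ k, A k, ENNReal.ofReal ((ℓ / (a - s)) ^ 2) * F s :=
        lintegral_mono_set hcover
    _ ≤ ∑' k, ∫⁻ s in A k, ENNReal.ofReal ((ℓ / (a - s)) ^ 2) * F s := lintegral_iUnion_le _ _
    _ ≤ ∑' k, ENNReal.ofReal (8 * (1 / 2) ^ k) * maxT F t := ENNReal.tsum_le_tsum hshell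
    _ = 16 * maxT F t := by rw [ENNReal.tsum_mul_right, hgeom]

end Time

section Mixed

variable {Θ : Type*} [MeasurableSpace Θ]

lemma sq_rpow_one_div_two_mul (u : ℝ≥0∞) {H : ℝ} : (u ^ 2) ^ (1 / (2 * H)) = u ^ (1 / H) := by
  rw [← ENNReal.rpow_natCast, ← ENNReal.rpow_mul]
  congr 1
  push_cast
  rcases eq_or_ne H 0 with h | h
  · simp [h]
  · field_simp

/-- The `L²_s L^{1/H}_θ` norm of `u`, written in terms of `u²`. -/
noncomputable def mixedNorm (H : ℝ) (ν : Measure Θ) (μ : Measure ℝ) (u : ℝ → Θ → ℝ≥0∞) : ℝ≥0∞ :=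
  (∫⁻ s, (∫⁻ θ, (u s θ ^ 2) ^ (1 / (2 * H)) ∂ν) ^ (2 * H) ∂μ) ^ ((1 : ℝ) / 2)

lemma lintegral_sq_rpow_le {H : ℝ} (hH : 0 < H) (ν : Measure Θ) {c : ℝ≥0∞} (hc : c ≠ ∞)
    {w m : Θ → ℝ≥0∞} (h : ∀ θ, w θ ≤ c * m θ) :
    (∫⁻ θ, w θ ^ (1 / (2 * H)) ∂ν) ^ (2 * H) ≤
      c * (∫⁻ θ, m θ ^ (1 / (2 * H)) ∂ν) ^ (2 * H) := by
  have h2H : 0 < 2 * H := by positivity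
  have h1 : 0 ≤ 1 / (2 * H) := by positivity
  calc _ ≤ (∫⁻ θ, c ^ (1 / (2 * H)) * m θ ^ (1 / (2 * H)) ∂ν) ^ (2 * H) := by
        refine ENNReal.rpow_le_rpow (lintegral_mono fun θ => ?_) h2H.le
        rw [← ENNReal.mul_rpow_of_nonneg _ _ h1]
        exact ENNReal.rpow_le_rpow (h θ) h1
    _ = _ := by
        rw [lintegral_const_mul' _ _ (ENNReal.rpow_ne_top_of_nonneg h1 hc),
          ENNReal.mul_rpow_of_nonneg _ _ h2H.le, ← ENNReal.rpow_mul,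
          one_div_mul_cancel h2H.ne', ENNReal.rpow_one]

lemma mixedNorm_mono_measure {H : ℝ} {ν : Measure Θ} {μ μ' : Measure ℝ} (h : μ ≤ μ')
    (u : ℝ → Θ → ℝ≥0∞) : mixedNorm H ν μ u ≤ mixedNorm H ν μ' u :=
  ENNReal.rpow_le_rpow (lintegral_mono' h le_rfl) (by norm_num)

lemma mixedNorm_add_measure_le {H : ℝ} {ν : Measure Θ} {μ μ' : Measure ℝ}
    (u : ℝ → Θ → ℝ≥0∞) :
    mixedNorm H ν (μ + μ') u ≤ mixedNorm H ν μ u + mixedNorm H ν μ' u := by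
  unfold mixedNorm
  rw [lintegral_add_measure]
  exact ENNReal.rpow_add_le_add_rpow _ _ (by norm_num) (by norm_num)

lemma mixedNorm_le_add {H : ℝ} (hH : 0 < H) (hH1 : H ≤ 1) {ν : Measure Θ} [SFinite ν]
    {μ : Measure ℝ} {u v w : ℝ → Θ → ℝ≥0∞}
    (hv : Measurable (Function.uncurry v)) (hw : Measurable (Function.uncurry w))
    (h : ∀ᵐ s ∂μ, ∀ θ, u s θ ≤ v s θ + w s θ) :
    mixedNorm H ν μ u ≤ mixedNorm H ν μ v + mixedNorm H ν μ w := by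
  have hp : 1 ≤ 1 / H := by rwa [le_div_iff₀ hH, one_mul]
  have hp0 : 0 ≤ 1 / H := by positivity
  set n : (ℝ → Θ → ℝ≥0∞) → ℝ → ℝ≥0∞ :=
    fun u s => (∫⁻ θ, u s θ ^ (1 / H) ∂ν) ^ (1 / (1 / H)) with hn
  have key : ∀ u, mixedNorm H ν μ u = (∫⁻ s, n u s ^ (2 : ℝ) ∂μ) ^ ((1 : ℝ) / 2) := fun u => by
    unfold mixedNorm
    simp only [hn, sq_rpow_one_div_two_mul, ← ENNReal.rpow_mul, one_div_one_div, mul_comm H 2]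
  have hnm : ∀ u : ℝ → Θ → ℝ≥0∞, Measurable (Function.uncurry u) → Measurable (n u) :=
    fun u hu => ((hu.pow_const (1 / H)).lintegral_prod_right').pow_const _
  rw [key, key, key]
  refine le_trans ?_ (ENNReal.lintegral_Lp_add_le (hnm v hv).aemeasurable (hnm w hw).aemeasurable
    one_le_two)
  refine ENNReal.rpow_le_rpow (lintegral_mono_ae ?_) (by norm_num)
  filter_upwards [h] with s hs
  refine ENNReal.rpow_le_rpow ?_ zero_le_two
  refine le_trans ?_ (ENNReal.lintegral_Lp_add_le (hv.comp measurable_prodMk_left).aemeasurable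
    (hw.comp measurable_prodMk_left).aemeasurable hp)
  exact ENNReal.rpow_le_rpow (lintegral_mono fun θ => ENNReal.rpow_le_rpow (hs θ) hp0)
    (by positivity)

lemma mixedNorm_le_of_sq_le {H : ℝ} (hH : 0 < H) {ν : Measure Θ} {μ : Measure ℝ}
    {u m : ℝ → Θ → ℝ≥0∞} {k : ℝ → ℝ≥0∞} (hk : ∀ s, k s ≠ ∞)
    (h : ∀ᵐ s ∂μ, ∀ θ, u s θ ^ 2 ≤ k s * m s θ) :
    mixedNorm H ν μ u ≤
      (∫⁻ s, k s * (∫⁻ θ, m s θ ^ (1 / (2 * H)) ∂ν) ^ (2 * H) ∂μ) ^ ((1 : ℝ) / 2) := by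
  refine ENNReal.rpow_le_rpow (lintegral_mono_ae ?_) (by norm_num)
  filter_upwards [h] with s hs
  exact lintegral_sq_rpow_le hH ν (hk s) hs

lemma lintegral_mixed_le {Y : Type*} [MeasurableSpace Y] {H : ℝ} (hH : 1 / 2 < H) {ν : Measure Θ}
    [SFinite ν] {μ : Measure Y} [IsFiniteMeasure μ] {J : Set ℝ} (hJ : MeasurableSet J)
    {u : ℝ → Y → Θ → ℝ≥0∞}
    (hu : Measurable fun q : (ℝ × Y) × Θ => u q.1.1 q.1.2 q.2) {m : ℝ → Θ → ℝ≥0∞} {c : ℝ≥0∞}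
    (hc : c ≠ ∞) (h : ∀ s ∈ J, ∀ θ, ∫⁻ y, u s y θ ∂μ ≤ c * m s θ) :
    ∫⁻ y, (∫⁻ s in J, (∫⁻ θ, u s y θ ^ (1 / (2 * H)) ∂ν) ^ (2 * H)) ∂μ ≤
      c * ∫⁻ s in J, (∫⁻ θ, m s θ ^ (1 / (2 * H)) ∂ν) ^ (2 * H) := by
  have h2H : 1 < 2 * H := by linarith
  rw [lintegral_lintegral_swap, ← lintegral_const_mul' _ _ hc]
  · refine setLIntegral_mono' hJ fun s hs => ?_
    refine le_trans (lintegral_rpow_lintegral_le h2H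
      (F := fun y θ => u s y θ ^ (1 / (2 * H))) ?_) ?_
    · have h2 : Measurable fun p : Y × Θ => ((s, p.1), p.2) := by fun_prop
      exact (hu.comp h2).pow_const _
    · simp only [← ENNReal.rpow_mul, one_div_mul_cancel (zero_lt_one.trans h2H).ne',
        ENNReal.rpow_one]
      exact lintegral_sq_rpow_le (by linarith) ν hc (h s hs)
  · refine Measurable.aemeasurable ?_
    have h1 : Measurable fun p : ℝ × Y => (∫⁻ θ, u p.1 p.2 θ ^ (1 / (2 * H)) ∂ν) ^ (2 * H) :=
      ((hu.pow_const (1 / (2 * H))).lintegral_prod_right').pow_const _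
    exact h1.comp measurable_swap

end Mixed

lemma measurable_uncurry_of_prod {S Y Θ : Type*} [MeasurableSpace S] [MeasurableSpace Y]
    [MeasurableSpace Θ] {w : Y → S → Θ → ℝ≥0∞}
    (hw : Measurable fun p : (S × Y) × Θ => w p.1.2 p.1.1 p.2) (y : Y) :
    Measurable (Function.uncurry (w y)) := by
  have h : Measurable fun p : S × Θ => ((p.1, y), p.2) := by fun_prop
  exact hw.comp h

section CalG

variable {d : ℕ} {V : Type} [NormedAddCommGroup V] [InnerProductSpace ℝ V]

local notation "𝔼" => EuclideanSpace ℝ (Fin d)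

/-- The gradient of `T_{t-s} f(s, ·, θ)` at `x`, for `q = (t, x)`. -/
noncomputable def gradAt (d : ℕ) {V : Type} [NormedAddCommGroup V] [InnerProductSpace ℝ V]
    (f : ℝ → EuclideanSpace ℝ (Fin d) → ℝ → V) (q : ℝ × EuclideanSpace ℝ (Fin d)) (s θ : ℝ) :
    PiLp 2 (fun _ : Fin d => V) :=
  heatGrad d (q.1 - s) (fun y => f s y θ) q.2

/-- The norm of the gradient of `T_{t-s} f(s, ·, θ)` at `x`, for `q = (t, x)`. -/
noncomputable def gradE (d : ℕ) {V : Type} [NormedAddCommGroup V] [InnerProductSpace ℝ V]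
    (f : ℝ → EuclideanSpace ℝ (Fin d) → ℝ → V) (q : ℝ × EuclideanSpace ℝ (Fin d)) (s θ : ℝ) :
    ℝ≥0∞ :=
  ‖gradAt d f q s θ‖ₑ

lemma stronglyMeasurable_gradAt {f : ℝ → 𝔼 → ℝ → V}
    (hf : StronglyMeasurable fun q : ℝ × 𝔼 × ℝ => f q.1 q.2.1 q.2.2) :
    StronglyMeasurable fun p : (ℝ × (ℝ × 𝔼)) × ℝ =>
      gradAt d f p.1.2 p.1.1 p.2 := by
  have h1 : StronglyMeasurable (Function.uncurry fun (r : ℝ × ℝ) (y : 𝔼) => f r.1 y r.2) :=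
    hf.comp_measurable (g := fun z : (ℝ × ℝ) × 𝔼 => (z.1.1, z.2, z.1.2)) (by fun_prop)
  have h2 := stronglyMeasurable_heatGrad h1
  have h3 : Measurable fun p : (ℝ × (ℝ × 𝔼)) × ℝ =>
      (((p.1.1, p.2), p.1.2.1 - p.1.1), p.1.2.2) := by fun_prop
  exact h2.comp_measurable h3

lemma measurable_gradE {f : ℝ → 𝔼 → ℝ → V}
    (hf : StronglyMeasurable fun q : ℝ × 𝔼 × ℝ => f q.1 q.2.1 q.2.2) :
    Measurable fun p : (ℝ × (ℝ × 𝔼)) × ℝ => gradE d f p.1.2 p.1.1 p.2 :=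
  (stronglyMeasurable_gradAt hf).enorm

lemma measurable_gradE_uncurry {f : ℝ → 𝔼 → ℝ → V}
    (hf : StronglyMeasurable fun q : ℝ × 𝔼 × ℝ => f q.1 q.2.1 q.2.2) (q : ℝ × 𝔼) :
    Measurable (Function.uncurry (gradE d f q)) :=
  measurable_uncurry_of_prod (measurable_gradE hf) q

lemma measurable_lintegral_gradE {f : ℝ → 𝔼 → ℝ → V}
    (hf : StronglyMeasurable fun q : ℝ × 𝔼 × ℝ => f q.1 q.2.1 q.2.2) (H : ℝ)
    (ν : Measure ℝ) [SFinite ν] :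
    Measurable fun p : ℝ × (ℝ × 𝔼) =>
      (∫⁻ θ, (gradE d f p.2 p.1 θ ^ 2) ^ (1 / (2 * H)) ∂ν) ^ (2 * H) := by
  have h := (((measurable_gradE hf).pow_const 2).pow_const (1 / (2 * H))).lintegral_prod_right'
    (ν := ν)
  exact h.pow_const _

variable [CompleteSpace V]

lemma calG_eq_integral {H : ℝ} (hH : 0 < H) {α β : EReal} {f : ℝ → 𝔼 → ℝ → V}
    (hf : StronglyMeasurable fun q : ℝ × 𝔼 × ℝ => f q.1 q.2.1 q.2.2)
    (hB : ∀ s θ, ∃ B, ∀ y, ‖f s y θ‖ ≤ B) (q : ℝ × 𝔼) :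
    calG d H α β f q.1 q.2 = (∫ s in Set.Iio q.1,
      ((∫⁻ θ in {θ : ℝ | α < (θ : EReal) ∧ (θ : EReal) < β},
        (gradE d f q s θ ^ 2) ^ (1 / (2 * H))) ^ (2 * H)).toReal) ^ ((1 : ℝ) / 2) := by
  unfold calG
  congr 1
  refine setIntegral_congr_fun measurableSet_Iio fun s hs => ?_
  have hs' : 0 < q.1 - s := sub_pos.2 hs
  have hsec : ∀ θ, StronglyMeasurable fun y => f s y θ := fun θ => by
    have h : Measurable fun y : 𝔼 => (s, y, θ) := by fun_prop
    exact hf.comp_measurable h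
  have hval : ∀ θ, gradHeatNormSq d (q.1 - s) (fun y => f s y θ) q.2 ^ (1 / (2 * H)) =
      ((gradE d f q s θ ^ 2) ^ (1 / (2 * H))).toReal := fun θ => by
    obtain ⟨B, hB⟩ := hB s θ
    rw [gradHeatNormSq_eq hs' (hsec θ) hB, ← ENNReal.toReal_rpow, gradE, gradAt, ENNReal.toReal_pow,
      toReal_enorm]
  simp only [hval]
  rw [← ENNReal.toReal_rpow]
  congr 1
  have hm : Measurable fun θ => (gradE d f q s θ ^ 2) ^ (1 / (2 * H)) := by
    have h := (measurable_gradE_uncurry hf q).comp (measurable_prodMk_left (x := s))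
    exact (h.pow_const 2).pow_const _
  rw [integral_eq_lintegral_of_nonneg_ae (Filter.Eventually.of_forall fun θ => toReal_nonneg)
    hm.ennreal_toReal.aestronglyMeasurable]
  congr 1
  refine lintegral_congr fun θ => ofReal_toReal ?_
  exact ENNReal.rpow_ne_top_of_nonneg (by positivity) (ENNReal.pow_ne_top enorm_ne_top)

lemma calG_eq_toReal {H : ℝ} (hH : 0 < H) {α β : EReal} {f : ℝ → 𝔼 → ℝ → V}
    (hf : StronglyMeasurable fun q : ℝ × 𝔼 × ℝ => f q.1 q.2.1 q.2.2)
    (hB : ∀ s θ, ∃ B, ∀ y, ‖f s y θ‖ ≤ B) (q : ℝ × 𝔼)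
    (htop : mixedNorm H (volume.restrict {θ : ℝ | α < (θ : EReal) ∧ (θ : EReal) < β})
      (volume.restrict (Set.Iio q.1)) (gradE d f q) ≠ ∞) :
    calG d H α β f q.1 q.2 =
      (mixedNorm H (volume.restrict {θ : ℝ | α < (θ : EReal) ∧ (θ : EReal) < β})
        (volume.restrict (Set.Iio q.1)) (gradE d f q)).toReal := by
  rw [calG_eq_integral hH hf hB]
  unfold mixedNorm at htop ⊢
  rw [← ENNReal.toReal_rpow]
  congr 1
  have hm : Measurable fun s => (∫⁻ θ in {θ : ℝ | α < (θ : EReal) ∧ (θ : EReal) < β},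
      (gradE d f q s θ ^ 2) ^ (1 / (2 * H))) ^ (2 * H) := by
    have h := (((measurable_gradE_uncurry hf q).pow_const 2).pow_const
      (1 / (2 * H))).lintegral_prod_right' (ν :=
        volume.restrict {θ : ℝ | α < (θ : EReal) ∧ (θ : EReal) < β})
    exact h.pow_const _
  refine integral_toReal hm.aemeasurable (ae_lt_top hm fun h => htop ?_)
  rw [h, ENNReal.top_rpow_of_pos (by norm_num)]

lemma measurable_setIntegral_Iio {Y : Type*} [MeasurableSpace Y] {a : Y → ℝ} (ha : Measurable a)
    {w : ℝ × Y → ℝ} (hw : Measurable w) : Measurable fun y => ∫ s in Set.Iio (a y), w (s, y) := by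
  have hset : MeasurableSet {p : Y × ℝ | p.2 < a p.1} :=
    measurableSet_lt measurable_snd (ha.comp measurable_fst)
  have h1 : StronglyMeasurable
      ({p : Y × ℝ | p.2 < a p.1}.indicator fun p => w (p.2, p.1)) :=
    ((hw.comp measurable_swap).indicator hset).stronglyMeasurable
  convert (h1.integral_prod_right' (ν := volume)).measurable using 2 with y
  rw [← integral_indicator measurableSet_Iio]
  rfl

lemma measurable_calG {H : ℝ} (hH : 0 < H) {α β : EReal} {f : ℝ → 𝔼 → ℝ → V}
    (hf : StronglyMeasurable fun q : ℝ × 𝔼 × ℝ => f q.1 q.2.1 q.2.2)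
    (hB : ∀ s θ, ∃ B, ∀ y, ‖f s y θ‖ ≤ B) :
    Measurable fun q : ℝ × 𝔼 => calG d H α β f q.1 q.2 := by
  have h1 := measurable_lintegral_gradE hf H
    (volume.restrict {θ : ℝ | α < (θ : EReal) ∧ (θ : EReal) < β})
  have h2 := measurable_setIntegral_Iio (measurable_fst (α := ℝ) (β := 𝔼)) h1.ennreal_toReal
  simp only [calG_eq_integral hH hf hB]
  exact h2.pow_const _

end CalG

section Cell

variable {d : ℕ}

local notation "𝔼" => EuclideanSpace ℝ (Fin d)

lemma measurableSet_box (u : Fin d → ℝ) (ℓ : ℝ) :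
    MeasurableSet {y : 𝔼 | ∀ j, y j ∈ Set.Ico (u j) (u j + ℓ)} := by
  have : {y : 𝔼 | ∀ j, y j ∈ Set.Ico (u j) (u j + ℓ)} =
      ⋂ j, (fun y : 𝔼 => y j) ⁻¹' Set.Ico (u j) (u j + ℓ) := by
    ext y; simp
  rw [this]
  exact MeasurableSet.iInter fun j =>
    (EuclideanSpace.proj (𝕜 := ℝ) j).continuous.measurable measurableSet_Ico

lemma volume_box (u : Fin d → ℝ) {ℓ : ℝ} (hℓ : 0 ≤ ℓ) :
    volume {y : 𝔼 | ∀ j, y j ∈ Set.Ico (u j) (u j + ℓ)} = ENNReal.ofReal (ℓ ^ d) := by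
  have h := (EuclideanSpace.volume_preserving_symm_measurableEquiv_toLp (Fin d)).measure_preimage
    (s := Set.univ.pi fun j => Set.Ico (u j) (u j + ℓ))
    (MeasurableSet.univ_pi fun j => measurableSet_Ico).nullMeasurableSet
  rw [Real.volume_pi_Ico] at h
  simp only [add_sub_cancel_left, Finset.prod_const, Finset.card_univ, Fintype.card_fin] at h
  rw [ENNReal.ofReal_pow hℓ, ← h]
  congr 1
  ext y
  simp [Set.mem_pi]

lemma exists_dyadicCell_eq (d : ℕ) (n : ℤ) (t : ℝ) (x : EuclideanSpace ℝ (Fin d)) :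
    ∃ (ℓ a : ℝ) (D : Set (EuclideanSpace ℝ (Fin d))), 0 < ℓ ∧ a ≤ t ∧ t < a + ℓ ^ 2 ∧
      MeasurableSet D ∧ x ∈ D ∧ (∀ w ∈ D, ‖w - x‖ ≤ √d * ℓ) ∧ volume D = ENNReal.ofReal (ℓ ^ d) ∧
      dyadicCell d n (t, x) = Set.Ico a (a + ℓ ^ 2) ×ˢ D := by
  set ℓ : ℝ := (2 : ℝ) ^ (-n) with hℓdef
  have hℓ : 0 < ℓ := by positivity
  have h4 : (4 : ℝ) ^ (-n) = ℓ ^ 2 := by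
    rw [hℓdef, ← zpow_natCast, ← zpow_mul, mul_comm, zpow_mul]
    norm_num
  have hinv2 : (2 : ℝ) ^ n = ℓ⁻¹ := by rw [hℓdef, zpow_neg, inv_inv]
  have hinv4 : (4 : ℝ) ^ n = (ℓ ^ 2)⁻¹ := by rw [← h4, zpow_neg, inv_inv]
  have hfl : ∀ (z c : ℝ), 0 < c → (⌊z * c⁻¹⌋ : ℝ) * c ≤ z ∧ z < (⌊z * c⁻¹⌋ : ℝ) * c + c :=
    fun z c hc => by
      have h1 := Int.floor_le (z * c⁻¹)
      have h2 := Int.lt_floor_add_one (z * c⁻¹)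
      rw [← div_eq_mul_inv] at *
      rw [le_div_iff₀ hc] at h1
      rw [div_lt_iff₀ hc] at h2
      exact ⟨h1, by linarith⟩
  set u : Fin d → ℝ := fun j => (⌊x j * ℓ⁻¹⌋ : ℝ) * ℓ with hu
  refine ⟨ℓ, (⌊t * (ℓ ^ 2)⁻¹⌋ : ℝ) * ℓ ^ 2, {y | ∀ j, y j ∈ Set.Ico (u j) (u j + ℓ)}, hℓ,
    (hfl t _ (by positivity)).1, (hfl t _ (by positivity)).2, measurableSet_box u ℓ,
    fun j => hfl (x j) ℓ hℓ, fun w hw => ?_, volume_box u hℓ.le, ?_⟩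
  · rw [EuclideanSpace.norm_eq, ← Real.sqrt_sq hℓ.le, ← Real.sqrt_mul (Nat.cast_nonneg d)]
    refine Real.sqrt_le_sqrt ?_
    calc ∑ j, ‖(w - x) j‖ ^ 2 ≤ ∑ _j : Fin d, ℓ ^ 2 := by
          refine Finset.sum_le_sum fun j _ => ?_
          have h1 := hw j
          have h2 := hfl (x j) ℓ hℓ
          rw [Real.norm_eq_abs, sq_abs, PiLp.sub_apply]
          refine sq_le_sq' ?_ ?_ <;> [skip; skip] <;>
            · have := h1.1; have := h1.2; simp only [hu] at *; linarith
      _ = d * ℓ ^ 2 := by simp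
  · unfold dyadicCell
    simp only [h4, hinv2, hinv4, add_mul, one_mul, ← hℓdef, hu]

lemma volume_Ico_prod {a ℓ : ℝ} {D : Set 𝔼}
    (hD : volume D = ENNReal.ofReal (ℓ ^ d)) :
    volume (Set.Ico a (a + ℓ ^ 2) ×ˢ D) = ENNReal.ofReal (ℓ ^ 2 * ℓ ^ d) := by
  rw [Measure.volume_eq_prod, Measure.prod_prod, Real.volume_Ico, hD, add_sub_cancel_left,
    ← ENNReal.ofReal_mul (by positivity)]

end Cell

section Oscillation

variable {Y : Type*} [MeasurableSpace Y]

lemma lintegral_abs_sub_average_le {μ : Measure Y} {A : Set Y} (hA : μ A ≠ 0) (hA' : μ A ≠ ∞)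
    {g : Y → ℝ} (hg : AEStronglyMeasurable g (μ.restrict A)) (c : ℝ) {M : ℝ≥0∞}
    (hM : ∫⁻ y in A, ENNReal.ofReal |g y - c| ∂μ ≤ μ A * M) :
    (μ A)⁻¹ * ∫⁻ y in A, ENNReal.ofReal |g y - (μ A).toReal⁻¹ * ∫ z in A, g z ∂μ| ∂μ ≤ 2 * M := by
  have : IsFiniteMeasure (μ.restrict A) := ⟨by simpa using hA'.lt_top⟩
  rcases eq_or_ne M ∞ with rfl | hMt
  · simp
  have hint : Integrable (fun y => g y - c) (μ.restrict A) := by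
    refine ⟨hg.sub aestronglyMeasurable_const, ?_⟩
    simp only [HasFiniteIntegral, ← ofReal_norm, Real.norm_eq_abs]
    exact hM.trans_lt (ENNReal.mul_lt_top hA'.lt_top hMt.lt_top)
  have hgi : Integrable g (μ.restrict A) := by
    exact (hint.add (integrable_const c)).congr (ae_of_all _ fun y => by simp)
  have hpos : 0 < (μ A).toReal := ENNReal.toReal_pos hA hA'
  set m := (μ A).toReal⁻¹ * ∫ z in A, g z ∂μ with hm
  have hmc : m - c = (μ A).toReal⁻¹ * ∫ z in A, (g z - c) ∂μ := by
    rw [integral_sub hgi (integrable_const c), setIntegral_const, hm, mul_sub, Measure.real,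
      smul_eq_mul, inv_mul_cancel_left₀ hpos.ne']
  have hdiff : ENNReal.ofReal |m - c| ≤ M := by
    rw [hmc, abs_mul, abs_of_pos (inv_pos.2 hpos), ENNReal.ofReal_mul (inv_pos.2 hpos).le,
      ENNReal.ofReal_inv_of_pos hpos, ofReal_toReal hA', ← Real.norm_eq_abs, ofReal_norm]
    calc (μ A)⁻¹ * ‖∫ z in A, (g z - c) ∂μ‖ₑ ≤ (μ A)⁻¹ * (μ A * M) := by
          refine mul_le_mul_right ((enorm_integral_le_lintegral_enorm _).trans ?_) _
          simpa only [← ofReal_norm, Real.norm_eq_abs] using hM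
      _ = M := by rw [← mul_assoc, ENNReal.inv_mul_cancel hA hA', one_mul]
  calc _ ≤ (μ A)⁻¹ * (μ A * M + M * μ A) := by
        refine mul_le_mul_right ?_ _
        calc _ ≤ ∫⁻ y in A, (ENNReal.ofReal |g y - c| + M) ∂μ := by
              refine lintegral_mono fun y => ?_
              refine le_trans (ENNReal.ofReal_le_ofReal (abs_sub_le (g y) c m)) ?_
              rw [ENNReal.ofReal_add (abs_nonneg _) (abs_nonneg _), abs_sub_comm c m]
              exact add_le_add_right hdiff _
          _ ≤ _ := by
              rw [lintegral_add_right _ measurable_const, setLIntegral_const]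
              exact add_le_add_left hM _
    _ = 2 * M := by
        rw [mul_comm M, ← two_mul, mul_left_comm, ← mul_assoc (μ A)⁻¹,
          ENNReal.inv_mul_cancel hA hA', one_mul]

lemma ofReal_abs_toReal_sub_le {x y z : ℝ≥0∞} (hy : y ≠ ∞) (h1 : x ≤ y + z) (h2 : y ≤ x + z) :
    ENNReal.ofReal |x.toReal - y.toReal| ≤ z := by
  rcases eq_or_ne z ∞ with rfl | hz
  · exact le_top
  have hx : x ≠ ∞ := ne_top_of_le_ne_top (ENNReal.add_ne_top.2 ⟨hy, hz⟩) h1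
  refine ENNReal.ofReal_le_of_le_toReal (abs_sub_le_iff.2 ⟨?_, ?_⟩)
  · have := ENNReal.toReal_mono (ENNReal.add_ne_top.2 ⟨hy, hz⟩) h1
    rw [ENNReal.toReal_add hy hz] at this
    linarith
  · have := ENNReal.toReal_mono (ENNReal.add_ne_top.2 ⟨hx, hz⟩) h2
    rw [ENNReal.toReal_add hx hz] at this
    linarith

lemma setLIntegral_rpow_half_le {μ : Measure Y} {A : Set Y} {b : Y → ℝ≥0∞} (hb : Measurable b) {M : ℝ≥0∞} (hM : ∫⁻ y in A, b y ∂μ ≤ μ A * M) :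
    ∫⁻ y in A, b y ^ ((1 : ℝ) / 2) ∂μ ≤ μ A * M ^ ((1 : ℝ) / 2) := by
  have h := ENNReal.lintegral_mul_le_Lp_mul_Lq (μ.restrict A) Real.HolderConjugate.two_two
    (f := fun y => b y ^ ((1 : ℝ) / 2)) (g := fun _ => 1) (hb.pow_const _).aemeasurable
    aemeasurable_const
  have e : ∀ y, (b y ^ ((1 : ℝ) / 2)) ^ (2 : ℝ) = b y := fun y => by
    rw [← ENNReal.rpow_mul]; norm_num
  simp only [Pi.mul_apply, mul_one, e, ENNReal.one_rpow, setLIntegral_const, one_mul] at h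
  refine h.trans ?_
  calc _ ≤ (μ A * M) ^ ((1 : ℝ) / 2) * μ A ^ ((1 : ℝ) / 2) :=
        mul_le_mul_left (ENNReal.rpow_le_rpow hM (by norm_num)) _
    _ = (μ A ^ ((1 : ℝ) / 2) * μ A ^ ((1 : ℝ) / 2)) * M ^ ((1 : ℝ) / 2) := by
        rw [ENNReal.mul_rpow_of_nonneg _ _ (by norm_num)]; ring
    _ = _ := by
        rw [← ENNReal.rpow_add_of_nonneg _ _ (by norm_num) (by norm_num)]; norm_num

end Oscillation

section Far

variable {d : ℕ} {V : Type} [NormedAddCommGroup V] [InnerProductSpace ℝ V]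

local notation "𝔼" => EuclideanSpace ℝ (Fin d)

lemma measurable_enorm_sub_of_prod {S Y Θ E : Type*} [MeasurableSpace S] [MeasurableSpace Y]
    [MeasurableSpace Θ] [NormedAddCommGroup E] {w : Y → S → Θ → E}
    (hw : StronglyMeasurable fun p : (S × Y) × Θ => w p.1.2 p.1.1 p.2) (y y' : Y) :
    Measurable (Function.uncurry fun s θ => ‖w y s θ - w y' s θ‖ₑ) := by
  have h (y : Y) : Measurable fun p : S × Θ => ((p.1, y), p.2) := by fun_prop
  exact ((hw.comp_measurable (h y)).sub (hw.comp_measurable (h y'))).enorm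

lemma stronglyMeasurable_section {S Y Θ E : Type*} [MeasurableSpace S] [MeasurableSpace Y]
    [MeasurableSpace Θ] [TopologicalSpace E] {f : S → Y → Θ → E}
    (hf : StronglyMeasurable fun q : S × Y × Θ => f q.1 q.2.1 q.2.2) (s : S) (θ : Θ) :
    StronglyMeasurable fun y => f s y θ := by
  have h : Measurable fun y : Y => (s, y, θ) := by fun_prop
  exact hf.comp_measurable h

/-- The distance between the gradients of `T_{t-s} f(s, ·, θ)` at two points of space-time. -/
noncomputable def gradDist (d : ℕ) {V : Type} [NormedAddCommGroup V] [InnerProductSpace ℝ V]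
    (f : ℝ → EuclideanSpace ℝ (Fin d) → ℝ → V) (q q' : ℝ × EuclideanSpace ℝ (Fin d)) (s θ : ℝ) :
    ℝ≥0∞ :=
  ‖gradAt d f q s θ - gradAt d f q' s θ‖ₑ

lemma measurable_gradDist {f : ℝ → 𝔼 → ℝ → V}
    (hf : StronglyMeasurable fun q : ℝ × 𝔼 × ℝ => f q.1 q.2.1 q.2.2) (q q' : ℝ × 𝔼) :
    Measurable (Function.uncurry (gradDist d f q q')) :=
  measurable_enorm_sub_of_prod (w := gradAt d f) (stronglyMeasurable_gradAt hf) q q'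

lemma gradE_le_add_gradDist (f : ℝ → 𝔼 → ℝ → V) (q q' : ℝ × 𝔼) (s θ : ℝ) :
    gradE d f q s θ ≤ gradE d f q' s θ + gradDist d f q q' s θ := by
  calc gradE d f q s θ = ‖gradAt d f q' s θ + (gradAt d f q s θ - gradAt d f q' s θ)‖ₑ := by
        rw [add_sub_cancel, gradE]
    _ ≤ _ := enorm_add_le _ _

lemma exists_mixedNorm_far_le (d : ℕ) :
    ∃ C : ℝ, 0 < C ∧ ∀ (V : Type) [NormedAddCommGroup V] [InnerProductSpace ℝ V] (H : ℝ)
      (α β : EReal) (f : ℝ → EuclideanSpace ℝ (Fin d) → ℝ → V) (t a ℓ : ℝ)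
      (x : EuclideanSpace ℝ (Fin d)) (q q' : ℝ × EuclideanSpace ℝ (Fin d)),
      StronglyMeasurable (fun q : ℝ × EuclideanSpace ℝ (Fin d) × ℝ => f q.1 q.2.1 q.2.2) →
      (∀ s θ, ∃ B, ∀ y, ‖f s y θ‖ ≤ B) → 0 < H → H ≤ 1 → 0 < ℓ → t ∈ Set.Ico a (a + ℓ ^ 2) →
      q.1 ∈ Set.Ico a (a + ℓ ^ 2) → q'.1 ∈ Set.Ico a (a + ℓ ^ 2) →
      ‖q.2 - x‖ ≤ √d * ℓ → ‖q'.2 - x‖ ≤ √d * ℓ →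
      mixedNorm H (volume.restrict {θ : ℝ | α < (θ : EReal) ∧ (θ : EReal) < β})
        (volume.restrict (Set.Iio (a - ℓ ^ 2))) (gradE d f q) ≤
      mixedNorm H (volume.restrict {θ : ℝ | α < (θ : EReal) ∧ (θ : EReal) < β})
        (volume.restrict (Set.Iio (a - ℓ ^ 2))) (gradE d f q') +
      (ENNReal.ofReal C * maxT (fun s => Ff d H α β f s x) t) ^ ((1 : ℝ) / 2) := by
  obtain ⟨C, hC, hfar⟩ := exists_enorm_heatGrad_sub_sq_le_maxX d
  refine ⟨C * 16, by positivity,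
    fun V _ _ H α β f t a ℓ x q q' hf hB hH hH1 hℓ ht hq hq' hqx hq'x => ?_⟩
  set ν : Measure ℝ := volume.restrict {θ : ℝ | α < (θ : EReal) ∧ (θ : EReal) < β} with hν
  refine (mixedNorm_le_add hH hH1 (measurable_gradE_uncurry hf q') (measurable_gradDist hf q q')
    (ae_of_all _ fun s θ => gradE_le_add_gradDist f q q' s θ)).trans (add_le_add_right ?_ _)
  refine (mixedNorm_le_of_sq_le hH (k := fun s => ENNReal.ofReal (C * (ℓ / (a - s)) ^ 2))
    (m := fun s θ => maxX d (fun y => ‖f s y θ‖ ^ 2) x) (fun _ => ofReal_ne_top) ?_).trans ?_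
  · refine ae_restrict_of_forall_mem measurableSet_Iio fun s hs θ => ?_
    obtain ⟨B, hB⟩ := hB s θ
    rw [Set.mem_Iio] at hs
    refine hfar V _ B x q.2 q'.2 ℓ (a - s) (q.1 - s) (q'.1 - s) (stronglyMeasurable_section hf s θ)
      hB hℓ (by linarith) ?_ ?_ ?_ hqx hq'x
    · exact ⟨by linarith [hq.1], by linarith [hq.2]⟩
    · exact ⟨by linarith [hq'.1], by linarith [hq'.2]⟩
    · rw [abs_le]
      constructor <;> linarith [hq.1, hq.2, hq'.1, hq'.2]
  · refine ENNReal.rpow_le_rpow ?_ (by norm_num)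
    calc ∫⁻ s in Set.Iio (a - ℓ ^ 2), ENNReal.ofReal (C * (ℓ / (a - s)) ^ 2) *
          Ff d H α β f s x
        = ∫⁻ s in Set.Iio (a - ℓ ^ 2), ENNReal.ofReal C *
            (ENNReal.ofReal ((ℓ / (a - s)) ^ 2) * Ff d H α β f s x) := by
          simp only [ENNReal.ofReal_mul hC.le, mul_assoc]
      _ = ENNReal.ofReal C * ∫⁻ s in Set.Iio (a - ℓ ^ 2),
            ENNReal.ofReal ((ℓ / (a - s)) ^ 2) * Ff d H α β f s x :=
          lintegral_const_mul' _ _ ofReal_ne_top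
      _ ≤ ENNReal.ofReal C * (16 * maxT (fun s => Ff d H α β f s x) t) :=
          mul_le_mul_right (lintegral_shells_le_maxT _ hℓ ht.1 ht.2) _
      _ = _ := by
          rw [ENNReal.ofReal_mul hC.le, mul_assoc]
          norm_num

lemma maxX_zero (x : 𝔼) : maxX d (fun _ => 0) x = 0 := by
  simp [maxX]

lemma Ff_eq_zero {H : ℝ} (hH : 0 < H) (α β : EReal) {f : ℝ → 𝔼 → ℝ → V} {s : ℝ}
    (hs : ∀ y θ, f s y θ = 0) (x : 𝔼) : Ff d H α β f s x = 0 := by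
  have h1 : 0 < 1 / (2 * H) := by positivity
  have h2 : 0 < 2 * H := by positivity
  unfold Ff
  simp only [hs, norm_zero, ne_eq, OfNat.ofNat_ne_zero, not_false_eq_true, zero_pow, maxX_zero,
    ENNReal.zero_rpow_of_pos h1, lintegral_zero, ENNReal.zero_rpow_of_pos h2]

lemma lintegral_Ff_ne_top {H : ℝ} (hH : 0 < H) (α β : EReal) {f : ℝ → 𝔼 → ℝ → V} {R : ℝ}
    (hR : ∀ s y θ, R < |s| → f s y θ = 0) {t : ℝ} {x : 𝔼}
    (hM : maxT (fun s => Ff d H α β f s x) t ≠ ∞) : ∫⁻ s, Ff d H α β f s x ≠ ∞ := by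
  set r := |t| + |R| + 1 with hr
  have hr0 : 0 < r := by positivity
  have hle : ∀ s, Ff d H α β f s x ≤
      (Set.Ioo (t - r) (t + r)).indicator (fun s => Ff d H α β f s x) s := fun s => by
    by_cases hs : s ∈ Set.Ioo (t - r) (t + r)
    · rw [Set.indicator_of_mem hs]
    · rw [Ff_eq_zero hH α β (fun y θ => hR s y θ ?_)]
      · exact zero_le
      · by_contra hsR
        apply hs
        have h1 := abs_le.1 (not_lt.1 hsR)
        have h2 := neg_abs_le t
        have h3 := le_abs_self t
        have h4 := le_abs_self R
        constructor <;> linarith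
  refine ne_top_of_le_ne_top (ENNReal.mul_ne_top ofReal_ne_top hM)
    (le_trans ?_ (setLIntegral_Ioo_le_maxT _ t hr0))
  rw [← lintegral_indicator measurableSet_Ioo]
  exact lintegral_mono hle

lemma mixedNorm_far_ne_top [CompleteSpace V] {H : ℝ} (hH : 0 < H) (α β : EReal)
    {f : ℝ → 𝔼 → ℝ → V}
    (hf : StronglyMeasurable fun q : ℝ × 𝔼 × ℝ => f q.1 q.2.1 q.2.2)
    (hB : ∀ s θ, ∃ B, ∀ y, ‖f s y θ‖ ≤ B) {R : ℝ} (hR : ∀ s y θ, R < |s| → f s y θ = 0)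
    {t b : ℝ} (hb : b < t) {x : 𝔼} (hM : maxT (fun s => Ff d H α β f s x) t ≠ ∞) :
    mixedNorm H (volume.restrict {θ : ℝ | α < (θ : EReal) ∧ (θ : EReal) < β})
        (volume.restrict (Set.Iio b)) (gradE d f (t, x)) ≠ ∞ := by
  obtain ⟨C, hC, hmax⟩ := exists_enorm_heatGrad_sq_le_maxX d
  refine ne_top_of_le_ne_top (b := (ENNReal.ofReal (C / (t - b)) * ∫⁻ s, Ff d H α β f s x) ^
    ((1 : ℝ) / 2)) (ENNReal.rpow_ne_top_of_nonneg (by norm_num)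
    (ENNReal.mul_ne_top ofReal_ne_top (lintegral_Ff_ne_top hH α β hR hM))) ?_
  refine (mixedNorm_le_of_sq_le hH (k := fun _ => ENNReal.ofReal (C / (t - b)))
    (m := fun s θ => maxX d (fun y => ‖f s y θ‖ ^ 2) x) (fun _ => ofReal_ne_top) ?_).trans ?_
  · refine ae_restrict_of_forall_mem measurableSet_Iio fun s hs θ => ?_
    obtain ⟨B, hB⟩ := hB s θ
    rw [Set.mem_Iio] at hs
    refine (hmax V _ B x (t - s) (stronglyMeasurable_section hf s θ) hB (by linarith)).trans
      (mul_le_mul_left (ENNReal.ofReal_le_ofReal ?_) _)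
    have : 0 < t - b := by linarith
    gcongr
  · refine ENNReal.rpow_le_rpow ?_ (by norm_num)
    rw [lintegral_const_mul' _ _ ofReal_ne_top]
    exact mul_le_mul_right (setLIntegral_le_lintegral _ _) _

end Far

section Near

lemma exists_lintegral_mixedNorm_near_le (d : ℕ) (hd : 1 ≤ d) :
    ∃ C : ℝ, 0 < C ∧ ∀ (V : Type) [NormedAddCommGroup V] [InnerProductSpace ℝ V]
      [CompleteSpace V] (H : ℝ) (α β : EReal) (f : ℝ → EuclideanSpace ℝ (Fin d) → ℝ → V)
      (t a ℓ : ℝ) (x : EuclideanSpace ℝ (Fin d)) (D : Set (EuclideanSpace ℝ (Fin d))),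
      StronglyMeasurable (fun q : ℝ × EuclideanSpace ℝ (Fin d) × ℝ => f q.1 q.2.1 q.2.2) →
      (∀ s θ, ∃ B, ∀ y, ‖f s y θ‖ ≤ B) → 1 / 2 < H → 0 < ℓ → t ∈ Set.Ico a (a + ℓ ^ 2) →
      MeasurableSet D → (∀ w ∈ D, ‖w - x‖ ≤ √d * ℓ) → volume D = ENNReal.ofReal (ℓ ^ d) →
      ∫⁻ q in Set.Ico a (a + ℓ ^ 2) ×ˢ D,
        mixedNorm H (volume.restrict {θ : ℝ | α < (θ : EReal) ∧ (θ : EReal) < β})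
          (volume.restrict (Set.Ico (a - ℓ ^ 2) q.1)) (gradE d f q) ≤
      volume (Set.Ico a (a + ℓ ^ 2) ×ˢ D) *
        (ENNReal.ofReal C * maxT (fun s => Ff d H α β f s x) t) ^ ((1 : ℝ) / 2) := by
  obtain ⟨C, hC, hnear⟩ := exists_setLIntegral_heatGrad_le_maxX d hd
  refine ⟨4 * C, by positivity,
    fun V _ _ _ H α β f t a ℓ x D hf hB hH hℓ ht hD hDx hDv => ?_⟩
  set ν : Measure ℝ := volume.restrict {θ : ℝ | α < (θ : EReal) ∧ (θ : EReal) < β} with hν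
  set Q := Set.Ico a (a + ℓ ^ 2) ×ˢ D with hQ
  have hQm : MeasurableSet Q := measurableSet_Ico.prod hD
  have hQv : volume Q = ENNReal.ofReal (ℓ ^ 2 * ℓ ^ d) := volume_Ico_prod hDv
  have hQt : volume Q ≠ ∞ := by rw [hQv]; exact ofReal_ne_top
  set J := Set.Ico (a - ℓ ^ 2) (a + ℓ ^ 2) with hJ
  set T : Set ((ℝ × (ℝ × EuclideanSpace ℝ (Fin d))) × ℝ) := {p | p.1.1 < p.1.2.1} with hT
  have hTm : MeasurableSet T := measurableSet_lt (by fun_prop) (by fun_prop)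
  set u : ℝ → (ℝ × EuclideanSpace ℝ (Fin d)) → ℝ → ℝ≥0∞ := fun s q θ =>
    T.indicator (fun p => gradE d f p.1.2 p.1.1 p.2 ^ 2) ((s, q), θ) with hu
  have hum : Measurable fun p : (ℝ × (ℝ × EuclideanSpace ℝ (Fin d))) × ℝ => u p.1.1 p.1.2 p.2 :=
    ((measurable_gradE hf).pow_const 2).indicator hTm
  set W : ℝ × (ℝ × EuclideanSpace ℝ (Fin d)) → ℝ≥0∞ := fun p =>
    (∫⁻ θ, u p.1 p.2 θ ^ (1 / (2 * H)) ∂ν) ^ (2 * H) with hW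
  have hWm : Measurable W :=
    ((hum.pow_const (1 / (2 * H))).lintegral_prod_right' (ν := ν)).pow_const (2 * H)
  have hbm : Measurable fun q => ∫⁻ s in J, W (s, q) := hWm.lintegral_prod_left'
  have hpt : ∀ q ∈ Q, mixedNorm H ν (volume.restrict (Set.Ico (a - ℓ ^ 2) q.1)) (gradE d f q) ≤
      (∫⁻ s in J, W (s, q)) ^ ((1 : ℝ) / 2) := fun q hq => by
    refine ENNReal.rpow_le_rpow ?_ (by norm_num)
    calc _ = ∫⁻ s in Set.Ico (a - ℓ ^ 2) q.1, W (s, q) := by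
          refine setLIntegral_congr_fun measurableSet_Ico fun s hs => ?_
          have : ∀ θ, u s q θ = gradE d f q s θ ^ 2 := fun θ => by
            simp only [hu]
            exact Set.indicator_of_mem (show ((s, q), θ) ∈ T from hs.2) _
          simp only [hW, this]
      _ ≤ _ := lintegral_mono_set (Set.Ico_subset_Ico_right hq.1.2.le)
  have hcell : ∀ s ∈ J, ∀ θ, ∫⁻ q in Q, u s q θ ≤
      ENNReal.ofReal (C * ℓ ^ d) * maxX d (fun y => ‖f s y θ‖ ^ 2) x := fun s hs θ => by
    obtain ⟨B, hB⟩ := hB s θ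
    refine le_trans ?_ (hnear V _ B x D s ℓ (stronglyMeasurable_section hf s θ) hB hℓ hD
      fun w hw => ?_)
    · have hSm : MeasurableSet {q : ℝ × EuclideanSpace ℝ (Fin d) | s < q.1} :=
        measurableSet_lt measurable_const measurable_fst
      calc ∫⁻ q in Q, u s q θ = ∫⁻ q in Q, {q : ℝ × EuclideanSpace ℝ (Fin d) | s < q.1}.indicator
            (fun q => gradE d f q s θ ^ 2) q := rfl
        _ = ∫⁻ q in {q : ℝ × EuclideanSpace ℝ (Fin d) | s < q.1} ∩ Q, gradE d f q s θ ^ 2 := by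
            rw [lintegral_indicator hSm, Measure.restrict_restrict hSm]
        _ ≤ _ := by
            refine lintegral_mono_set fun q hq => ⟨⟨hq.1, ?_⟩, hq.2.2⟩
            have h1 := hq.2.1.2
            have h2 := hs.1
            linarith
    · rw [norm_sub_rev]
      calc ‖w - x‖ ^ 2 ≤ (√d * ℓ) ^ 2 := pow_le_pow_left₀ (norm_nonneg _) (hDx w hw) 2
        _ = d * ℓ ^ 2 := by rw [mul_pow, Real.sq_sqrt (Nat.cast_nonneg d)]
  have : IsFiniteMeasure (volume.restrict Q) := ⟨by simpa using hQt.lt_top⟩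
  have hint : ∫⁻ q in Q, (∫⁻ s in J, W (s, q)) ≤
      volume Q * (ENNReal.ofReal (4 * C) * maxT (fun s => Ff d H α β f s x) t) := by
    refine (lintegral_mixed_le hH measurableSet_Ico hum ofReal_ne_top hcell).trans ?_
    have hJsub : J ⊆ Set.Ioo (t - 2 * ℓ ^ 2) (t + 2 * ℓ ^ 2) := fun s hs => by
      have := hs.1; have := hs.2; have := ht.1; have := ht.2
      have : 0 < ℓ ^ 2 := by positivity
      constructor <;> linarith
    calc ENNReal.ofReal (C * ℓ ^ d) * ∫⁻ s in J, Ff d H α β f s x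
        ≤ ENNReal.ofReal (C * ℓ ^ d) * (ENNReal.ofReal (2 * (2 * ℓ ^ 2)) *
            maxT (fun s => Ff d H α β f s x) t) :=
          mul_le_mul_right ((lintegral_mono_set hJsub).trans
            (setLIntegral_Ioo_le_maxT _ t (by positivity))) _
      _ = _ := by
          rw [hQv, ← mul_assoc, ← mul_assoc (ENNReal.ofReal (ℓ ^ 2 * ℓ ^ d)),
            ← ENNReal.ofReal_mul (by positivity), ← ENNReal.ofReal_mul (by positivity)]
          congr 2
          ring
  exact (setLIntegral_mono' hQm hpt).trans (setLIntegral_rpow_half_le hbm hint)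

end Near

section Assembly

variable {d : ℕ} {V : Type} [NormedAddCommGroup V] [InnerProductSpace ℝ V]

local notation "𝔼" => EuclideanSpace ℝ (Fin d)

lemma exists_bound_of_tsupport_subset {f : ℝ → 𝔼 → ℝ → V} {K : Set (ℝ × 𝔼)} (hK : IsCompact K)
    (hf : ∀ θ, Continuous fun q : ℝ × 𝔼 => f q.1 q.2 θ)
    (hfK : ∀ θ, tsupport (fun q : ℝ × 𝔼 => f q.1 q.2 θ) ⊆ K) (s θ : ℝ) :
    ∃ B, ∀ y, ‖f s y θ‖ ≤ B := by
  have hc : HasCompactSupport fun q : ℝ × 𝔼 => f q.1 q.2 θ :=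
    hK.of_isClosed_subset (isClosed_tsupport _) (hfK θ)
  obtain ⟨B, hB⟩ := hc.exists_bound_of_continuous (hf θ)
  exact ⟨B, fun y => hB (s, y)⟩

lemma exists_forall_eq_zero_of_tsupport_subset {f : ℝ → 𝔼 → ℝ → V} {K : Set (ℝ × 𝔼)}
    (hK : IsCompact K) (hfK : ∀ θ, tsupport (fun q : ℝ × 𝔼 => f q.1 q.2 θ) ⊆ K) :
    ∃ R : ℝ, ∀ s y θ, R < |s| → f s y θ = 0 := by
  obtain ⟨R, hR⟩ := hK.isBounded.exists_norm_le
  refine ⟨R, fun s y θ hs => ?_⟩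
  by_contra hne
  have h1 : (s, y) ∈ K :=
    hfK θ (subset_tsupport (fun q : ℝ × 𝔼 => f q.1 q.2 θ) hne)
  exact absurd ((norm_fst_le (s, y)).trans (hR _ h1)) (by simpa using hs)

lemma exists_lintegral_calG_sub_le (d : ℕ) (hd : 1 ≤ d) :
    ∃ N : ℝ, 0 < N ∧ ∀ (V : Type) [NormedAddCommGroup V] [InnerProductSpace ℝ V]
      [CompleteSpace V] (H : ℝ) (α β : EReal) (f : ℝ → EuclideanSpace ℝ (Fin d) → ℝ → V)
      (R t a ℓ : ℝ) (x : EuclideanSpace ℝ (Fin d)) (D : Set (EuclideanSpace ℝ (Fin d))),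
      StronglyMeasurable (fun q : ℝ × EuclideanSpace ℝ (Fin d) × ℝ => f q.1 q.2.1 q.2.2) →
      (∀ s θ, ∃ B, ∀ y, ‖f s y θ‖ ≤ B) → (∀ s y θ, R < |s| → f s y θ = 0) →
      H ∈ Set.Ioo (1 / 2 : ℝ) 1 → 0 < ℓ → t ∈ Set.Ico a (a + ℓ ^ 2) →
      MeasurableSet D → x ∈ D → (∀ w ∈ D, ‖w - x‖ ≤ √d * ℓ) →
      volume D = ENNReal.ofReal (ℓ ^ d) → maxT (fun s => Ff d H α β f s x) t ≠ ∞ →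
      ∃ c : ℝ, ∫⁻ q in Set.Ico a (a + ℓ ^ 2) ×ˢ D,
          ENNReal.ofReal |calG d H α β f q.1 q.2 - c| ≤
        volume (Set.Ico a (a + ℓ ^ 2) ×ˢ D) *
          (ENNReal.ofReal N * maxT (fun s => Ff d H α β f s x) t ^ ((1 : ℝ) / 2)) := by
  obtain ⟨C₁, hC₁, hfar⟩ := exists_mixedNorm_far_le d
  obtain ⟨C₂, hC₂, hnear⟩ := exists_lintegral_mixedNorm_near_le d hd
  refine ⟨C₂ ^ ((1 : ℝ) / 2) + C₁ ^ ((1 : ℝ) / 2), by positivity,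
    fun V _ _ _ H α β f R t a ℓ x D hf hB hR hH hℓ ht hD hxD hDx hDv hM => ?_⟩
  have hH0 : 0 < H := by linarith [hH.1]
  have hℓ2 : 0 < ℓ ^ 2 := by positivity
  set ν : Measure ℝ := volume.restrict {θ : ℝ | α < (θ : EReal) ∧ (θ : EReal) < β} with hν
  set M := maxT (fun s => Ff d H α β f s x) t with hMdef
  set b := a - ℓ ^ 2 with hb
  set far : ℝ × EuclideanSpace ℝ (Fin d) → ℝ≥0∞ := fun q =>
    mixedNorm H ν (volume.restrict (Set.Iio b)) (gradE d f q) with hfardef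
  set near : ℝ × EuclideanSpace ℝ (Fin d) → ℝ≥0∞ := fun q =>
    mixedNorm H ν (volume.restrict (Set.Ico b q.1)) (gradE d f q) with hneardef
  set total : ℝ × EuclideanSpace ℝ (Fin d) → ℝ≥0∞ := fun q =>
    mixedNorm H ν (volume.restrict (Set.Iio q.1)) (gradE d f q) with htotaldef
  set E := (ENNReal.ofReal C₁ * M) ^ ((1 : ℝ) / 2) with hE
  set Q := Set.Ico a (a + ℓ ^ 2) ×ˢ D with hQ
  have hEt : E ≠ ∞ :=
    ENNReal.rpow_ne_top_of_nonneg (by norm_num) (ENNReal.mul_ne_top ofReal_ne_top hM)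
  have hQm : MeasurableSet Q := measurableSet_Ico.prod hD
  have hfar₀ : far (t, x) ≠ ∞ :=
    mixedNorm_far_ne_top hH0 α β hf hB hR (by linarith [ht.1]) hM
  have hosc : ∀ q ∈ Q, ∀ q' ∈ Q, far q ≤ far q' + E := fun q hq q' hq' =>
    hfar V H α β f t a ℓ x q q' hf hB hH0 hH.2.le hℓ ht hq.1 hq'.1 (hDx _ hq.2) (hDx _ hq'.2)
  have h0Q : (t, x) ∈ Q := ⟨ht, hxD⟩
  have hpt : ∀ q ∈ Q, ENNReal.ofReal |calG d H α β f q.1 q.2 - (far (t, x)).toReal| ≤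
      near q + E := fun q hq => by
    have hbq : b ≤ q.1 := by linarith [hq.1.1]
    have hfar_le : far q ≤ total q :=
      mixedNorm_mono_measure (Measure.restrict_mono_set _ (Set.Iio_subset_Iio hbq)) _
    have htotal_le : total q ≤ far q + near q := by
      have : (volume : Measure ℝ).restrict (Set.Iio q.1) =
          volume.restrict (Set.Iio b) + volume.restrict (Set.Ico b q.1) := by
        rw [← Set.Iio_union_Ico_eq_Iio hbq]
        refine Measure.restrict_union ?_ measurableSet_Ico
        exact Set.disjoint_left.2 fun s h1 h2 => absurd h1 (not_lt.2 h2.1)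
      simp only [htotaldef, this]
      exact mixedNorm_add_measure_le _
    have h1 : total q ≤ far (t, x) + (near q + E) :=
      calc total q ≤ far q + near q := htotal_le
        _ ≤ far (t, x) + E + near q := add_le_add_left (hosc q hq _ h0Q) _
        _ = _ := by ring
    have h2 : far (t, x) ≤ total q + (near q + E) :=
      calc far (t, x) ≤ far q + E := hosc _ h0Q q hq
        _ ≤ total q + (near q + E) := add_le_add hfar_le le_add_self
    rcases eq_or_ne (near q) ∞ with hn | hn
    · rw [hn, top_add]
      exact le_top
    · have htop : total q ≠ ∞ := ne_top_of_le_ne_top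
        (ENNReal.add_ne_top.2 ⟨hfar₀, ENNReal.add_ne_top.2 ⟨hn, hEt⟩⟩) h1
      rw [calG_eq_toReal hH0 hf hB q htop]
      exact ofReal_abs_toReal_sub_le hfar₀ h1 h2
  refine ⟨(far (t, x)).toReal, (setLIntegral_mono' hQm hpt).trans ?_⟩
  rw [lintegral_add_right _ measurable_const, setLIntegral_const]
  calc (∫⁻ q in Q, near q) + E * volume Q
      ≤ volume Q * (ENNReal.ofReal C₂ * M) ^ ((1 : ℝ) / 2) + volume Q * E := by
        rw [mul_comm E]
        exact add_le_add_left
          (hnear V H α β f t a ℓ x D hf hB hH.1 hℓ ht hD hDx hDv) _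
    _ = _ := by
        rw [hE, ENNReal.mul_rpow_of_nonneg _ _ (by norm_num),
          ENNReal.mul_rpow_of_nonneg _ _ (by norm_num), ENNReal.ofReal_rpow_of_pos hC₁,
          ENNReal.ofReal_rpow_of_pos hC₂, ENNReal.ofReal_add (by positivity) (by positivity)]
        ring

end Assembly

/-- Pointwise sharp-function estimate:
`(𝒢f)^#(t,x) ≤ N (𝕄_t[F_f(·,x)](t))^{1/2}` for every `(t,x)`, with `N = N(d)`. -/
theorem calG_sharp_function_bound (d : ℕ) (hd : 1 ≤ d) :
    ∃ N : ℝ, 0 < N ∧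
      ∀ (V : Type) [NormedAddCommGroup V] [InnerProductSpace ℝ V] [CompleteSpace V]
        [TopologicalSpace.SeparableSpace V]
        (H : ℝ), H ∈ Set.Ioo (1/2 : ℝ) 1 →
      ∀ (α β : EReal), α < β →
      ∀ (f : ℝ → EuclideanSpace ℝ (Fin d) → ℝ → V),
        StronglyMeasurable
          (fun q : ℝ × EuclideanSpace ℝ (Fin d) × ℝ => f q.1 q.2.1 q.2.2) →
        (∀ θ, ContDiff ℝ (⊤ : ℕ∞)
          (fun q : ℝ × EuclideanSpace ℝ (Fin d) => f q.1 q.2 θ)) →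
        (∃ K : Set (ℝ × EuclideanSpace ℝ (Fin d)), IsCompact K ∧
          ∀ θ, tsupport (fun q : ℝ × EuclideanSpace ℝ (Fin d) => f q.1 q.2 θ) ⊆ K) →
        ∀ (t : ℝ) (x : EuclideanSpace ℝ (Fin d)),
        sharpFn d (fun q => calG d H α β f q.1 q.2) (t, x) ≤
          ENNReal.ofReal N * (maxT (fun s => Ff d H α β f s x) t) ^ ((1:ℝ)/2) := by
  obtain ⟨N, hN, hcell⟩ := exists_lintegral_calG_sub_le d hd
  refine ⟨2 * N, by positivity, fun V _ _ _ _ H hH α β _ f hf hsmooth hK t x => ?_⟩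
  obtain ⟨K, hK, hfK⟩ := hK
  rcases eq_or_ne (maxT (fun s => Ff d H α β f s x) t) ∞ with hM | hM
  · rw [hM, ENNReal.top_rpow_of_pos (by norm_num), ENNReal.mul_top (by simpa using hN)]
    exact le_top
  have hB := exists_bound_of_tsupport_subset hK (fun θ => (hsmooth θ).continuous) hfK
  obtain ⟨R, hR⟩ := exists_forall_eq_zero_of_tsupport_subset hK hfK
  have hH0 : 0 < H := by linarith [hH.1]
  refine iSup_le fun n => ?_
  obtain ⟨ℓ, a, D, hℓ, hat, hta, hD, hxD, hDx, hDv, hcelleq⟩ := exists_dyadicCell_eq d n t x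
  obtain ⟨c, hc⟩ := hcell V H α β f R t a ℓ x D hf hB hR hH hℓ ⟨hat, hta⟩ hD hxD hDx hDv hM
  have hvol := volume_Ico_prod (a := a) hDv
  rw [ENNReal.ofReal_mul zero_le_two, mul_assoc, ENNReal.ofReal_ofNat, cellAvg, hcelleq]
  refine lintegral_abs_sub_average_le ?_ ?_
    (measurable_calG hH0 hf hB).aestronglyMeasurable c hc
  · rw [hvol]
    simp only [ne_eq, ENNReal.ofReal_eq_zero, not_le]
    positivity
  · rw [hvol]
    exact ofReal_ne_top
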